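/- Let Ω ⊂ ℝ^N (N ≥ 2) be a smooth bounded open set, let m ≥ 1, n ≥ 1 and 1 < r ≤ N be integers, set t := m mod r, and let γ satisfy γ ≥ Nr/(N+t) and 1 < γ < ∞. Then there is a constant C such that for every u ∈ C^∞(Ω̄, ℝ^n): ‖u‖_{W^{m−m/r,r}(Ω)} ≤ C ‖u‖_{W^{m−[m/r],γ}(Ω)}; i.e., W^{m−[m/r],γ}(Ω,ℝ^n) embeds continuously into W^{m−m/r,r}(Ω,ℝ^n). Here [m/r] denotes the integer part of m/r. -/

import Mathlib

open MeasureTheory Filter Topology Real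

noncomputable section

abbrev Euc (N : ℕ) := EuclideanSpace ℝ (Fin N)

/-- The (full signed) determinant of an `m`-dimensional matrix of order `N^m`:
`det A = ∑_{τ_2,…,τ_m ∈ S_N} (∏_{s=2}^m sgn τ_s) ∏_{k=1}^N a_{k τ_2(k) ⋯ τ_m(k)}`. -/
def hyperDet {N : ℕ} : {m : ℕ} → ((Fin m → Fin N) → ℝ) → ℝ
  | 0, A => A finZeroElim
  | m + 1, A =>
      ∑ τ : Fin m → Equiv.Perm (Fin N),
        (∏ s, ((Equiv.Perm.sign (τ s) : ℤ) : ℝ)) *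
          ∏ k : Fin N, A (Fin.cons k fun s => τ s k)

/-- classical partial derivative `∂_i f`. -/
def pderiv' {N : ℕ} (i : Fin N) (f : Euc N → ℝ) : Euc N → ℝ :=
  fun x => fderiv ℝ f x (EuclideanSpace.single i 1)

/-- iterated partial derivative `∂_{l_1} ∂_{l_2} ⋯ f`. -/
def pderivList {N : ℕ} : List (Fin N) → (Euc N → ℝ) → Euc N → ℝ
  | [], f => f
  | i :: l, f => pderiv' i (pderivList l f)

/-- the `m`th-Jacobian `(β,α)`-minor `M^β_α(D^m u)` of `u : Ω → ℝ^n`, i.e. the hyper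
determinant of the `(m+1)`-dimensional matrix of order `r^{m+1}` with entries
`∂_{α^1_{l_1}} ⋯ ∂_{α^m_{l_m}} u^{β_{l_0}}`. -/
def jacMinor {N n : ℕ} (m r : ℕ) (β : Fin r → Fin n) (α : Fin m → Fin r → Fin N)
    (u : Euc N → Fin n → ℝ) (x : Euc N) : ℝ :=
  hyperDet (m := m + 1) fun l : Fin (m + 1) → Fin r =>
    pderivList (List.ofFn fun s : Fin m => α s (l s.succ)) (fun y => u y (β (l 0))) x

/-- the `m`th-Jacobian `α`-minor `M_α(D^m v)` of a scalar function `v`. -/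
def scalMinor {N : ℕ} (m r : ℕ) (α : Fin m → Fin r → Fin N)
    (v : Euc N → ℝ) (x : Euc N) : ℝ :=
  hyperDet (m := m) fun l : Fin m → Fin r =>
    pderivList (List.ofFn fun s : Fin m => α s (l s)) v x

/-- the integer Sobolev norm `‖u‖_{W^{k,p}(Ω)} = ∑_{j ≤ k} ‖D^j u‖_{L^p(Ω)}`. -/
def intSobNorm {N : ℕ} {F : Type*} [NormedAddCommGroup F] [NormedSpace ℝ F]
    (Ω : Set (Euc N)) (k : ℕ) (p : ℝ) (u : Euc N → F) : ℝ :=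
  ∑ j ∈ Finset.range (k + 1), (∫ x in Ω, ‖iteratedFDeriv ℝ j u x‖ ^ p) ^ (1 / p)

open Classical in
/-- the (possibly fractional) Sobolev norm `‖u‖_{W^{s,p}(Ω)}`: for integer `s` the usual
Sobolev norm, for non-integer `s` the `W^{[s],p}` norm plus the Gagliardo seminorm of
`D^{[s]} u` with fractional exponent `s - [s]`. -/
def sobNorm {N : ℕ} {F : Type*} [NormedAddCommGroup F] [NormedSpace ℝ F]
    (Ω : Set (Euc N)) (s p : ℝ) (u : Euc N → F) : ℝ :=
  if ∃ k : ℕ, s = k then intSobNorm Ω ⌊s⌋₊ p u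
  else
    intSobNorm Ω ⌊s⌋₊ p u +
      (∫ x in Ω, ∫ y in Ω,
          ‖iteratedFDeriv ℝ ⌊s⌋₊ u x - iteratedFDeriv ℝ ⌊s⌋₊ u y‖ ^ p /
            ‖x - y‖ ^ ((N : ℝ) + (s - ⌊s⌋₊) * p)) ^ (1 / p)

/-- `‖D^m ψ‖_{L^∞}`, the sup of the `m`-th derivatives of `ψ`. -/
def supDm {N : ℕ} (m : ℕ) (ψ : Euc N → ℝ) : ℝ := ⨆ x, ‖iteratedFDeriv ℝ m ψ x‖

/-- `ψ ∈ C_c^∞(Ω)`. -/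
def IsCinfc {N : ℕ} (Ω : Set (Euc N)) (ψ : Euc N → ℝ) : Prop :=
  ContDiff ℝ (⊤ : ℕ∞) ψ ∧ HasCompactSupport ψ ∧ tsupport ψ ⊆ Ω

/-- `Ω` is a smooth bounded open subset of `ℝ^N`. -/
def IsSmoothDomain {N : ℕ} (Ω : Set (Euc N)) : Prop :=
  IsOpen Ω ∧ Bornology.IsBounded Ω ∧
    ∃ f : Euc N → ℝ, ContDiff ℝ (⊤ : ℕ∞) f ∧ Ω = {x | f x < 0} ∧
      ∀ x ∈ frontier Ω, fderiv ℝ f x ≠ 0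

open Set in
theorem lintegral_comp_smul_of_pos {N : ℕ} (f : Euc N → ENNReal) {R : ℝ} (hR : 0 < R) :
    ∫⁻ x, f (R • x) = ENNReal.ofReal (R ^ (-(N : ℝ))) * ∫⁻ x, f x := by
  have h := lintegral_map_equiv (μ := (volume : Measure (Euc N))) f
    (Homeomorph.smulOfNeZero (α := Euc N) R hR.ne').toMeasurableEquiv
  have h2 : Measure.map (Homeomorph.smulOfNeZero (α := Euc N) R hR.ne').toMeasurableEquiv
      (volume : Measure (Euc N)) = ENNReal.ofReal (R ^ (-(N : ℝ))) • volume := by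
    have := Measure.map_addHaar_smul (volume : Measure (Euc N)) hR.ne'
    rw [finrank_euclideanSpace_fin] at this
    rw [Real.rpow_neg hR.le, Real.rpow_natCast, ← abs_of_pos (a := (R ^ N)⁻¹) (by positivity)]
    exact this
  rw [h2, lintegral_smul_measure] at h
  exact h.symm

theorem lintegral_weight_min_lt_top {N : ℕ} (hN : 1 ≤ N) {t q s : ℝ} (ht : 0 < t)
    (hs : 0 < s) (hqs : t < q * s) :
    ∫⁻ k : Euc N, ENNReal.ofReal (‖k‖ ^ (t - N)) *
      (min 1 (ENNReal.ofReal (‖k‖ ^ (-q)))) ^ s < ⊤ := by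
  have : Nontrivial (Euc N) := by
    have : Nonempty (Fin N) := ⟨⟨0, hN⟩⟩
    infer_instance
  have hintg : Integrable (fun k : Euc N => (‖k‖ ^ (t - N)) * (min 1 (‖k‖ ^ (-q))) ^ s) := by
    rw [integrable_fun_norm_addHaar (volume : Measure (Euc N))
      (f := fun y : ℝ => (y ^ (t - N)) * (min 1 (y ^ (-q))) ^ s), finrank_euclideanSpace_fin]
    rw [← Set.Ioc_union_Ioi_eq_Ioi (zero_le_one : (0:ℝ) ≤ 1)]
    have hm : Measurable (fun y : ℝ => y ^ (N - 1) • (y ^ (t - N) * min 1 (y ^ (-q)) ^ s)) := by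
      simp only [smul_eq_mul]
      fun_prop
    have key : ∀ y : ℝ, 0 < y → y ^ (N - 1) * y ^ (t - N) = y ^ (t - 1) := by
      intro y hy
      rw [← Real.rpow_natCast, ← Real.rpow_add hy]
      congr 1
      rw [Nat.cast_sub hN]; push_cast; ring
    refine IntegrableOn.union ?_ ?_
    · have h1 : IntegrableOn (fun y : ℝ => y ^ (t - 1)) (Set.Ioc 0 1) := by
        rw [← intervalIntegrable_iff_integrableOn_Ioc_of_le zero_le_one]
        exact intervalIntegral.intervalIntegrable_rpow' (by linarith)
      refine h1.mono' hm.aestronglyMeasurable ?_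
      filter_upwards [ae_restrict_mem measurableSet_Ioc] with y hy
      rw [smul_eq_mul, ← mul_assoc, key y hy.1, Real.norm_of_nonneg (by have := hy.1; positivity)]
      have h0 := hy.1
      have : min 1 (y ^ (-q)) ^ s ≤ 1 :=
        Real.rpow_le_one (by positivity) (min_le_left _ _) hs.le
      exact mul_le_of_le_one_right (by positivity) this
    · have h1 : IntegrableOn (fun y : ℝ => y ^ (t - 1 - q * s)) (Set.Ioi 1) :=
        integrableOn_Ioi_rpow_of_lt (by linarith) one_pos
      refine h1.mono' hm.aestronglyMeasurable ?_
      filter_upwards [ae_restrict_mem measurableSet_Ioi] with y hy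
      have h0 : (0:ℝ) < y := lt_trans one_pos hy
      rw [smul_eq_mul, ← mul_assoc, key y h0, Real.norm_of_nonneg (by positivity)]
      have : min 1 (y ^ (-q)) ^ s ≤ y ^ (- (q * s)) := by
        rw [← neg_mul, Real.rpow_mul h0.le]
        exact Real.rpow_le_rpow (by positivity) (min_le_right _ _) hs.le
      calc _ ≤ y ^ (t - 1) * y ^ (- (q * s)) := by gcongr
        _ = _ := by rw [← Real.rpow_add h0]; rfl
  have h2 := hintg.lintegral_lt_top
  refine lt_of_le_of_lt (le_of_eq ?_) h2
  refine lintegral_congr fun k => ?_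
  rw [ENNReal.ofReal_mul (by positivity), ← ENNReal.ofReal_rpow_of_nonneg (by positivity) hs.le]
  congr 2
  rw [← ENNReal.ofReal_one, ENNReal.ofReal_min]

theorem lintegral_weight_min_eq {N : ℕ} {t q s : ℝ} (hq : 0 < q) (hs : 0 < s)
    {a M : ℝ} (ha : 0 < a) (hM : 0 < M) :
    ∫⁻ h : Euc N, ENNReal.ofReal (‖h‖ ^ (t - N)) *
      (min (ENNReal.ofReal a) (ENNReal.ofReal M * ENNReal.ofReal (‖h‖ ^ (-q)))) ^ s =
    ENNReal.ofReal (a ^ (s - t / q)) * ENNReal.ofReal (M ^ (t / q)) *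
     ∫⁻ k : Euc N, ENNReal.ofReal (‖k‖ ^ (t - N)) *
      (min 1 (ENNReal.ofReal (‖k‖ ^ (-q)))) ^ s := by
  set R : ℝ := (M / a) ^ (1 / q) with hR
  have hR0 : 0 < R := by positivity
  have hRq : R ^ (-q) = a / M := by
    rw [hR, ← Real.rpow_mul (by positivity)]
    have : 1 / q * -q = -1 := by field_simp
    rw [this, Real.rpow_neg_one, inv_div]
  have hRt : R ^ t = M ^ (t / q) * a ^ (-(t / q)) := by
    have : 1 / q * t = t / q := by ring
    rw [hR, ← Real.rpow_mul (by positivity), this, Real.div_rpow hM.le ha.le,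
      Real.rpow_neg ha.le, div_eq_mul_inv]
  set f : Euc N → ENNReal := fun h => ENNReal.ofReal (‖h‖ ^ (t - N)) *
      (min (ENNReal.ofReal a) (ENNReal.ofReal M * ENNReal.ofReal (‖h‖ ^ (-q)))) ^ s with hf
  have h1 := lintegral_comp_smul_of_pos f hR0
  have h2 : ∫⁻ x, f x = ENNReal.ofReal (R ^ (N : ℝ)) * ∫⁻ x, f (R • x) := by
    rw [h1, ← mul_assoc, ← ENNReal.ofReal_mul (by positivity), ← Real.rpow_add hR0]
    simp
  rw [h2]
  have h3 : ∀ x, f (R • x) = ENNReal.ofReal (R ^ (t - N) * a ^ s) *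
      (ENNReal.ofReal (‖x‖ ^ (t - N)) * (min 1 (ENNReal.ofReal (‖x‖ ^ (-q)))) ^ s) := by
    intro x
    simp only [hf, norm_smul, Real.norm_of_nonneg hR0.le]
    rw [Real.mul_rpow hR0.le (norm_nonneg _), Real.mul_rpow hR0.le (norm_nonneg _), hRq,
      ← ENNReal.ofReal_mul hM.le]
    have e1 : M * (a / M * ‖x‖ ^ (-q)) = a * ‖x‖ ^ (-q) := by field_simp
    rw [e1, ENNReal.ofReal_mul ha.le]
    have e2 : min (ENNReal.ofReal a) (ENNReal.ofReal a * ENNReal.ofReal (‖x‖ ^ (-q)))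
        = ENNReal.ofReal a * min 1 (ENNReal.ofReal (‖x‖ ^ (-q))) := by
      rw [mul_min, mul_one]
    rw [e2, ENNReal.mul_rpow_of_nonneg _ _ hs.le, ENNReal.ofReal_mul (by positivity),
      ENNReal.ofReal_mul (by positivity), ENNReal.ofReal_rpow_of_pos ha]
    ring
  simp_rw [h3]
  rw [lintegral_const_mul' _ _ ENNReal.ofReal_ne_top, ← mul_assoc,
    ← ENNReal.ofReal_mul (by positivity), ← ENNReal.ofReal_mul (by positivity)]
  congr 2
  rw [← mul_assoc, ← Real.rpow_add hR0]
  have : (N : ℝ) + (t - N) = t := by ring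
  rw [this, hRt, Real.rpow_sub ha, Real.rpow_neg ha.le]
  field_simp

theorem lintegral_weight_min_le {N : ℕ} {t q s : ℝ} (hq : 0 < q) (hs : 0 < s)
    {a M : ENNReal} (ha : a ≠ ⊤) (hM : M ≠ ⊤) (hM0 : M ≠ 0) :
    a * ∫⁻ h : Euc N, ENNReal.ofReal (‖h‖ ^ (t - N)) *
      (min a (M * ENNReal.ofReal (‖h‖ ^ (-q)))) ^ s ≤
    a ^ (1 + s - t / q) * M ^ (t / q) *
     ∫⁻ k : Euc N, ENNReal.ofReal (‖k‖ ^ (t - N)) *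
      (min 1 (ENNReal.ofReal (‖k‖ ^ (-q)))) ^ s := by
  rcases eq_or_ne a 0 with rfl | ha0
  · simp
  have ha' := ENNReal.toReal_pos ha0 ha
  have hM' := ENNReal.toReal_pos hM0 hM
  have := lintegral_weight_min_eq (N := N) (t := t) hq hs ha' hM'
  rw [ENNReal.ofReal_toReal ha, ENNReal.ofReal_toReal hM, ← ENNReal.ofReal_rpow_of_pos ha',
    ← ENNReal.ofReal_rpow_of_pos hM', ENNReal.ofReal_toReal ha, ENNReal.ofReal_toReal hM] at this
  rw [this, ← mul_assoc, ← mul_assoc]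
  gcongr
  rw [add_sub_assoc, ENNReal.rpow_add _ _ ha0 ha, ENNReal.rpow_one]

theorem lintegral_le_lintegral_rpow_mul {α : Type*} [MeasurableSpace α] {μ : Measure α}
    {p : ℝ} (hp : 1 ≤ p) {f : α → ENNReal} (hf : AEMeasurable f μ) :
    ∫⁻ x, f x ∂μ ≤ (∫⁻ x, f x ^ p ∂μ) ^ (1 / p) * μ Set.univ ^ (1 - 1 / p) := by
  have h := eLpNorm'_le_eLpNorm'_mul_rpow_measure_univ (μ := μ) (f := f) one_pos hp
    hf.aestronglyMeasurable
  simpa [eLpNorm'] using h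

theorem lintegral_rpow_le_mul_lintegral_rpow {α : Type*} [MeasurableSpace α] {μ : Measure α}
    {p : ℝ} (hp : 1 ≤ p) {f : α → ENNReal} (hf : AEMeasurable f μ) :
    (∫⁻ x, f x ∂μ) ^ p ≤ μ Set.univ ^ (p - 1) * ∫⁻ x, f x ^ p ∂μ := by
  have h0 : 0 < p := by linarith
  refine (ENNReal.rpow_le_rpow (lintegral_le_lintegral_rpow_mul hp hf) h0.le).trans ?_
  rw [ENNReal.mul_rpow_of_nonneg _ _ h0.le, ← ENNReal.rpow_mul, ← ENNReal.rpow_mul,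
    one_div_mul_cancel h0.ne', ENNReal.rpow_one, mul_comm, show (1 - 1 / p) * p = p - 1 by field_simp]

/-- Only the part of `f` above a fixed fraction of its mean matters for the mean. -/
theorem lintegral_rpow_le_lintegral_mul_min {α : Type*} [MeasurableSpace α] {μ : Measure α}
    [IsFiniteMeasure μ] (hμ : μ ≠ 0) {f : α → ENNReal} (hf : Measurable f) {s : ℝ} (hs : 0 < s)
    {K : ENNReal} (hK : K ≠ ⊤) (hfK : ∫⁻ x, f x ∂μ ≤ K) :
    (∫⁻ x, f x ∂μ) ^ (1 + s) ≤
      2 * ∫⁻ x, f x * (min (2 * μ Set.univ * f x) K) ^ s ∂μ := by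
  set G := ∫⁻ x, f x ∂μ with hG
  have hGtop : G ≠ ⊤ := ne_top_of_le_ne_top hK hfK
  set c := 2 * μ Set.univ with hc
  have hc0 : c ≠ 0 := by simp [hc, hμ]
  have hct : c ≠ ⊤ := ENNReal.mul_ne_top (by simp) (measure_ne_top _ _)
  set S := {x | G ≤ c * f x} with hS
  have hSm : MeasurableSet S := measurableSet_le measurable_const (hf.const_mul c)
  have h1 : ∫⁻ x in Sᶜ, f x ∂μ ≤ G / 2 := by
    calc ∫⁻ x in Sᶜ, f x ∂μ ≤ ∫⁻ x in Sᶜ, G / c ∂μ := by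
          refine setLIntegral_mono measurable_const fun x hx => ?_
          have : c * f x < G := by simpa [hS] using hx
          rw [ENNReal.le_div_iff_mul_le (Or.inl hc0) (Or.inl hct), mul_comm]
          exact this.le
      _ ≤ G / c * μ Set.univ := by
          rw [setLIntegral_const]; gcongr; exact Set.subset_univ _
      _ = G / 2 := by
          rw [hc, ENNReal.div_eq_inv_mul, ENNReal.mul_inv (by simp) (by simp), ENNReal.div_eq_inv_mul]
          have h0 : μ Set.univ ≠ 0 := by simpa using hμ
          calc 2⁻¹ * (μ Set.univ)⁻¹ * G * μ Set.univ
              = 2⁻¹ * G * ((μ Set.univ)⁻¹ * μ Set.univ) := by ring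
            _ = _ := by rw [ENNReal.inv_mul_cancel h0 (measure_ne_top _ _), mul_one]
  have h2 : G ≤ 2 * ∫⁻ x in S, f x ∂μ := by
    have h3 : G = ∫⁻ x in S, f x ∂μ + ∫⁻ x in Sᶜ, f x ∂μ := (lintegral_add_compl f hSm).symm
    have h4 : G / 2 + G / 2 ≤ ∫⁻ x in S, f x ∂μ + G / 2 := by
      rw [ENNReal.add_halves]
      exact h3.le.trans (by gcongr)
    have h5 : G / 2 ≠ ⊤ := ENNReal.div_ne_top hGtop (by simp)
    have h6 := (ENNReal.add_le_add_iff_right h5).1 h4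
    rw [ENNReal.div_le_iff (by simp) (by simp), mul_comm] at h6
    exact h6
  calc G ^ (1 + s) = G * G ^ s := by
        rw [ENNReal.rpow_add_of_nonneg _ _ zero_le_one hs.le, ENNReal.rpow_one]
    _ ≤ 2 * (∫⁻ x in S, f x ∂μ) * G ^ s := by gcongr
    _ = 2 * ∫⁻ x in S, f x * G ^ s ∂μ := by
        rw [lintegral_mul_const _ hf, mul_assoc]
    _ ≤ 2 * ∫⁻ x in S, f x * (min (c * f x) K) ^ s ∂μ := by
        gcongr 2 * ?_
        refine setLIntegral_mono (by fun_prop) fun x hx => ?_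
        gcongr
        exact le_min hx hfK
    _ ≤ _ := by
        gcongr 2 * ?_
        exact setLIntegral_le_lintegral _ _

theorem setLIntegral_add_smul_le {N : ℕ} (B : Set (Euc N)) {p : ℝ} (hp : 1 ≤ p)
    {g : Euc N → ENNReal} (hg : Measurable g) (x : Euc N) {ρ : ℝ} (hρ : 0 < ρ) :
    ∫⁻ b in B, g (x + ρ • b) ≤
      volume B ^ (1 - 1 / p) * (∫⁻ z, g z ^ p) ^ (1 / p) * ENNReal.ofReal (ρ ^ (-(N / p))) := by
  have h0 : 0 < p := by linarith
  have h1 := lintegral_le_lintegral_rpow_mul (μ := volume.restrict B) hp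
    (f := fun b => g (x + ρ • b)) (by fun_prop)
  refine h1.trans ?_
  rw [Measure.restrict_apply_univ, mul_comm, mul_assoc]
  gcongr
  have h2 : ∫⁻ b in B, g (x + ρ • b) ^ p ≤ ENNReal.ofReal (ρ ^ (-(N : ℝ))) * ∫⁻ z, g z ^ p := by
    refine (setLIntegral_le_lintegral _ _).trans (le_of_eq ?_)
    rw [lintegral_comp_smul_of_pos (fun b => g (x + b) ^ p) hρ,
      lintegral_add_left_eq_self (fun z => g z ^ p) x]
  refine (ENNReal.rpow_le_rpow h2 (by positivity)).trans (le_of_eq ?_)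
  rw [ENNReal.mul_rpow_of_nonneg _ _ (by positivity), ENNReal.ofReal_rpow_of_pos (by positivity),
    ← Real.rpow_mul hρ.le, mul_comm]
  congr 3
  ring

/-- The critical `L^p` bound for averages over dilated copies of a set. -/
theorem exists_lintegral_average_le {N : ℕ} (hN : 1 ≤ N) {B : Set (Euc N)}
    (hB0 : volume B ≠ 0) (hBt : volume B ≠ ⊤) {t r p : ℝ} (ht : 0 < t) (htN : t < N) (hr : 1 < r)
    (hp1 : 1 < p) (hpr : p * (N + t) = N * r) :
    ∃ C : ENNReal, C ≠ ⊤ ∧ ∀ g : Euc N → ENNReal, Measurable g → (∀ x, g x ≠ ⊤) →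
      ∫⁻ x, ∫⁻ h : Euc N, ENNReal.ofReal (‖h‖ ^ (t - N)) * (∫⁻ b in B, g (x + ‖h‖ • b)) ^ r ≤
        C * (∫⁻ z, g z ^ p) ^ (r / p) := by
  have hN0 : (0:ℝ) < N := by exact_mod_cast hN
  set q : ℝ := N / p with hq
  have hp0 : 0 < p := by linarith
  have hq0 : 0 < q := by positivity
  set s : ℝ := r - 1 with hs
  have hs0 : 0 < s := by rw [hs]; linarith
  have hqs : t < q * s := by
    rw [hq, hs, div_mul_eq_mul_div, lt_div_iff₀ hp0]
    nlinarith
  have hexp : 1 + s - t / q = p := by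
    rw [hs, hq]
    field_simp
    linarith
  have hexp2 : 1 / p * (t / q) + 1 = r / p := by
    rw [hq]; field_simp; linarith
  have : IsFiniteMeasure ((volume : Measure (Euc N)).restrict B) := ⟨by
    rw [Measure.restrict_apply_univ]; exact hBt.lt_top⟩
  set K0 : ENNReal := ∫⁻ k : Euc N, ENNReal.ofReal (‖k‖ ^ (t - N)) *
      (min 1 (ENNReal.ofReal (‖k‖ ^ (-q)))) ^ s with hK0
  have hK0t : K0 ≠ ⊤ := (lintegral_weight_min_lt_top hN ht hs0 hqs).ne
  set c : ENNReal := 2 * volume B with hc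
  have hc0 : c ≠ 0 := by simp [hc, hB0]
  have hct : c ≠ ⊤ := ENNReal.mul_ne_top (by simp) hBt
  set C1 : ENNReal := volume B ^ (1 - 1 / p) with hC1
  have hp2 : 0 ≤ 1 - 1 / p := by
    rw [sub_nonneg, div_le_one hp0]; exact hp1.le
  have hC1t : C1 ≠ ⊤ := ENNReal.rpow_ne_top_of_nonneg hp2 hBt
  have hC10 : C1 ≠ 0 := by
    rw [hC1]; exact (ENNReal.rpow_pos (pos_iff_ne_zero.2 hB0) hBt).ne'
  set D : ENNReal := 2 * (volume B * (c⁻¹ * (c ^ p * C1 ^ (t / q) * K0))) with hD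
  have htq : 0 ≤ t / q := by positivity
  have hDt : D ≠ ⊤ := by
    refine ENNReal.mul_ne_top (by simp) (ENNReal.mul_ne_top hBt (ENNReal.mul_ne_top
      (by simpa using hc0) (ENNReal.mul_ne_top (ENNReal.mul_ne_top ?_ ?_) hK0t)))
    · exact ENNReal.rpow_ne_top_of_nonneg hp0.le hct
    · exact ENNReal.rpow_ne_top_of_nonneg htq hC1t
  refine ⟨D + 1, by simp [hDt], fun g hg hgt => ?_⟩
  set I := ∫⁻ z, g z ^ p with hI
  rcases eq_or_ne I ⊤ with hIt | hIt
  · rw [hIt, ENNReal.top_rpow_of_pos (by positivity), ENNReal.mul_top (by simp)]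
    exact le_top
  have hG : ∀ x (h : Euc N), h ≠ 0 → ∫⁻ b in B, g (x + ‖h‖ • b) ≤
      C1 * I ^ (1 / p) * ENNReal.ofReal (‖h‖ ^ (-q)) := fun x h hh =>
    setLIntegral_add_smul_le B hp1.le hg x (norm_pos_iff.2 hh)
  rcases eq_or_ne I 0 with hI0 | hI0
  · refine le_of_eq_of_le ?_ zero_le
    rw [lintegral_eq_zero_iff' (Measurable.aemeasurable (by fun_prop))]
    refine Eventually.of_forall fun x => ?_
    have : Nonempty (Fin N) := ⟨⟨0, hN⟩⟩
    simp only [Pi.zero_apply]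
    rw [lintegral_eq_zero_iff' (Measurable.aemeasurable (by fun_prop))]
    have h0 : ∀ᵐ h : Euc N, h ≠ 0 := by
      simp [ae_iff, measure_singleton]
    filter_upwards [h0] with h hh
    have := hG x h hh
    rw [hI0, ENNReal.zero_rpow_of_pos (by positivity)] at this
    simp only [mul_zero, zero_mul, nonpos_iff_eq_zero] at this
    simp [this, ENNReal.zero_rpow_of_pos (by linarith : 0 < r)]
  set M := C1 * I ^ (1 / p) with hM
  have hMt : M ≠ ⊤ := ENNReal.mul_ne_top hC1t (ENNReal.rpow_ne_top_of_nonneg (by positivity) hIt)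
  have hM0 : M ≠ 0 := mul_ne_zero hC10 (ENNReal.rpow_pos (pos_iff_ne_zero.2 hI0) hIt).ne'
  set Φ : Euc N → Euc N → ENNReal := fun z h => ENNReal.ofReal (‖h‖ ^ (t - N)) *
    (g z * (min (c * g z) (M * ENNReal.ofReal (‖h‖ ^ (-q)))) ^ s) with hΦ
  have hΦm : Measurable (Function.uncurry Φ) := by
    simp only [hΦ, Function.uncurry_def]
    fun_prop
  have step1 : ∀ x (h : Euc N),
      ENNReal.ofReal (‖h‖ ^ (t - N)) * (∫⁻ b in B, g (x + ‖h‖ • b)) ^ r ≤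
        2 * ∫⁻ b in B, Φ (x + ‖h‖ • b) h := by
    intro x h
    rcases eq_or_ne h 0 with rfl | hh
    · simp [Real.zero_rpow (sub_ne_zero.2 htN.ne)]
    have h1 := lintegral_rpow_le_lintegral_mul_min (μ := volume.restrict B)
      (by simpa [Measure.restrict_eq_zero] using hB0) (f := fun b => g (x + ‖h‖ • b))
      (by fun_prop) hs0
      (K := M * ENNReal.ofReal (‖h‖ ^ (-q))) (ENNReal.mul_ne_top hMt ENNReal.ofReal_ne_top)
      (hG x h hh)
    rw [Measure.restrict_apply_univ] at h1
    have h2 : 1 + s = r := by rw [hs]; ring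
    rw [h2] at h1
    calc _ ≤ _ := mul_le_mul_right h1 _
      _ = _ := by
        rw [mul_left_comm, ← lintegral_const_mul' _ _ ENNReal.ofReal_ne_top]
  calc _ ≤ ∫⁻ x, ∫⁻ h : Euc N, 2 * ∫⁻ b in B, Φ (x + ‖h‖ • b) h :=
        lintegral_mono fun x => lintegral_mono fun h => step1 x h
    _ = ∫⁻ h : Euc N, ∫⁻ x, 2 * ∫⁻ b in B, Φ (x + ‖h‖ • b) h := by
        rw [lintegral_lintegral_swap]
        refine Measurable.aemeasurable ?_
        simp only [Function.uncurry_def]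
        refine Measurable.const_mul (Measurable.lintegral_prod_right' (f := fun z : (Euc N × Euc N) × Euc N => Φ (z.1.1 + ‖z.1.2‖ • z.2) z.1.2) ?_) _
        exact hΦm.comp (f := fun z : (Euc N × Euc N) × Euc N => (z.1.1 + ‖z.1.2‖ • z.2, z.1.2)) (by fun_prop)
    _ = ∫⁻ h : Euc N, 2 * ∫⁻ b in B, ∫⁻ x, Φ (x + ‖h‖ • b) h := by
        refine lintegral_congr fun h => ?_
        rw [lintegral_const_mul' _ _ (by simp), lintegral_lintegral_swap]
        refine Measurable.aemeasurable ?_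
        exact hΦm.comp (f := fun z : Euc N × Euc N => (z.1 + ‖h‖ • z.2, h)) (by fun_prop)
    _ = ∫⁻ h : Euc N, 2 * (volume B * ∫⁻ z, Φ z h) := by
        refine lintegral_congr fun h => ?_
        congr 1
        have : ∀ b, ∫⁻ x, Φ (x + ‖h‖ • b) h = ∫⁻ z, Φ z h := fun b =>
          lintegral_add_right_eq_self (fun z => Φ z h) _
        simp_rw [this]
        rw [setLIntegral_const, mul_comm]
    _ = 2 * (volume B * ∫⁻ z, ∫⁻ h, Φ z h) := by
        rw [lintegral_const_mul' _ _ (by simp), lintegral_const_mul' _ _ hBt,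
          lintegral_lintegral_swap]
        exact (hΦm.comp measurable_swap).aemeasurable
    _ ≤ 2 * (volume B * ∫⁻ z, c⁻¹ * (c ^ p * C1 ^ (t / q) * K0) * (I ^ (1 / p * (t / q)) * g z ^ p)) := by
        gcongr with z
        have h1 := lintegral_weight_min_le (N := N) (t := t) hq0 hs0
          (a := c * g z) (ENNReal.mul_ne_top hct (hgt z)) hMt hM0
        rw [hexp, ENNReal.mul_rpow_of_nonneg _ _ hp0.le, hM, ENNReal.mul_rpow_of_nonneg _ _ htq,
          ← ENNReal.rpow_mul I, ← hM, ← hK0] at h1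
        calc ∫⁻ h, Φ z h = c⁻¹ * (c * g z * ∫⁻ h : Euc N, ENNReal.ofReal (‖h‖ ^ (t - N)) *
              (min (c * g z) (M * ENNReal.ofReal (‖h‖ ^ (-q)))) ^ s) := by
              rw [← mul_assoc, ← mul_assoc, ENNReal.inv_mul_cancel hc0 hct, one_mul,
                ← lintegral_const_mul' _ _ (hgt z)]
              refine lintegral_congr fun h => ?_
              simp only [hΦ]; ring
          _ ≤ _ := mul_le_mul_right h1 _
          _ = _ := by ring
    _ = D * I ^ (r / p) := by
        rw [lintegral_const_mul' _ _ (by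
          refine (ENNReal.mul_ne_top
            (by simpa using hc0) (ENNReal.mul_ne_top (ENNReal.mul_ne_top ?_ ?_) hK0t))
          · exact ENNReal.rpow_ne_top_of_nonneg hp0.le hct
          · exact ENNReal.rpow_ne_top_of_nonneg htq hC1t),
          lintegral_const_mul' _ _ (ENNReal.rpow_ne_top_of_nonneg (by positivity) hIt), ← hI,
          ← hexp2, ENNReal.rpow_add _ _ hI0 hIt, ENNReal.rpow_one]
        ring
    _ ≤ _ := by gcongr; exact le_self_add

theorem lintegral_Ioo_rpow_ne_top {a : ℝ} (ha : -1 < a) :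
    ∫⁻ s in Set.Ioo (0 : ℝ) 1, ENNReal.ofReal (s ^ a) ≠ ⊤ := by
  have h : IntegrableOn (fun s : ℝ => s ^ a) (Set.Ioo 0 1) := by
    have := (intervalIntegral.intervalIntegrable_rpow' (a := 0) (b := 1) ha)
    rw [intervalIntegrable_iff_integrableOn_Ioc_of_le zero_le_one] at this
    exact this.mono_set Set.Ioo_subset_Ioc_self
  exact h.lintegral_lt_top.ne

/-- A weighted Hölder inequality on the unit interval. -/
theorem exists_lintegral_Ioo_rpow_le {β r : ℝ} (hr : 1 < r) (hβ : β < r - 1) :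
    ∃ C : ENNReal, C ≠ ⊤ ∧ ∀ f : ℝ → ENNReal, Measurable f →
      (∫⁻ s in Set.Ioo (0 : ℝ) 1, f s) ^ r ≤
        C * ∫⁻ s in Set.Ioo (0 : ℝ) 1, ENNReal.ofReal (s ^ β) * f s ^ r := by
  have hr0 : 0 < r := by linarith
  have hr1 : 0 < r - 1 := by linarith
  set r' := r.conjExponent with hr'
  have hc : r'.HolderConjugate r := (Real.HolderConjugate.conjExponent hr).symm
  have hr'v : r' = r / (r - 1) := rfl
  have hr'0 : 0 < r' := by rw [hr'v]; positivity
  set A := ∫⁻ s in Set.Ioo (0 : ℝ) 1, ENNReal.ofReal (s ^ (-(β / (r - 1)))) with hA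
  have hAt : A ≠ ⊤ := lintegral_Ioo_rpow_ne_top (by
    rw [neg_lt_neg_iff, div_lt_one hr1]; exact hβ)
  refine ⟨A ^ (1 / r' * r), ENNReal.rpow_ne_top_of_nonneg (by positivity) hAt, fun f hf => ?_⟩
  have h1 := ENNReal.lintegral_mul_le_Lp_mul_Lq (volume.restrict (Set.Ioo (0 : ℝ) 1)) hc
    (f := fun s => ENNReal.ofReal (s ^ (-(β / r))))
    (g := fun s => ENNReal.ofReal (s ^ (β / r)) * f s)
    (by fun_prop) (by fun_prop)
  have e1 : ∫⁻ s in Set.Ioo (0 : ℝ) 1, ((fun s => ENNReal.ofReal (s ^ (-(β / r)))) *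
      (fun s => ENNReal.ofReal (s ^ (β / r)) * f s)) s = ∫⁻ s in Set.Ioo (0 : ℝ) 1, f s := by
    refine setLIntegral_congr_fun measurableSet_Ioo fun s hs => ?_
    have h0 : 0 < s := hs.1
    simp only [Pi.mul_apply]
    rw [← mul_assoc, ← ENNReal.ofReal_mul (by positivity), ← Real.rpow_add h0]
    simp
  have e2 : ∫⁻ s in Set.Ioo (0 : ℝ) 1, (ENNReal.ofReal (s ^ (-(β / r)))) ^ r' = A := by
    refine setLIntegral_congr_fun measurableSet_Ioo fun s hs => ?_
    have h0 : 0 < s := hs.1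
    rw [ENNReal.ofReal_rpow_of_pos (by positivity), ← Real.rpow_mul h0.le, hr'v]
    congr 2
    field_simp
  have e3 : ∫⁻ s in Set.Ioo (0 : ℝ) 1, (ENNReal.ofReal (s ^ (β / r)) * f s) ^ r =
      ∫⁻ s in Set.Ioo (0 : ℝ) 1, ENNReal.ofReal (s ^ β) * f s ^ r := by
    refine setLIntegral_congr_fun measurableSet_Ioo fun s hs => ?_
    have h0 : 0 < s := hs.1
    rw [ENNReal.mul_rpow_of_nonneg _ _ hr0.le, ENNReal.ofReal_rpow_of_pos (by positivity),
      ← Real.rpow_mul h0.le, div_mul_cancel₀ _ hr0.ne']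
  rw [e1, e2, e3] at h1
  refine (ENNReal.rpow_le_rpow h1 hr0.le).trans (le_of_eq ?_)
  rw [ENNReal.mul_rpow_of_nonneg _ _ hr0.le, ← ENNReal.rpow_mul, ← ENNReal.rpow_mul,
    one_div_mul_cancel hr0.ne', ENNReal.rpow_one]

/-- The critical bound for averages over dilated copies of a set, averaged over all smaller
scales. -/
theorem exists_lintegral_scale_average_le {N : ℕ} (hN : 1 ≤ N) {B : Set (Euc N)}
    (hB0 : volume B ≠ 0) (hBt : volume B ≠ ⊤) {t r p : ℝ} (ht : 0 < t) (htN : t < N)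
    (hr : 1 < r) (htr : t < r) (hp1 : 1 < p) (hpr : p * (N + t) = N * r) :
    ∃ C : ENNReal, C ≠ ⊤ ∧ ∀ g : Euc N → ENNReal, Measurable g → (∀ x, g x ≠ ⊤) →
      ∫⁻ x, ∫⁻ h : Euc N, ENNReal.ofReal (‖h‖ ^ (t - N)) *
        (∫⁻ s in Set.Ioo (0 : ℝ) 1, ∫⁻ b in B, g (x + (s * ‖h‖) • b)) ^ r ≤
        C * (∫⁻ z, g z ^ p) ^ (r / p) := by
  obtain ⟨C, hC, H⟩ := exists_lintegral_average_le hN hB0 hBt ht htN hr hp1 hpr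
  set β := (t + r) / 2 - 1 with hβ
  obtain ⟨A, hA, HA⟩ := exists_lintegral_Ioo_rpow_le (β := β) hr (by rw [hβ]; linarith)
  set D := ∫⁻ s in Set.Ioo (0 : ℝ) 1, ENNReal.ofReal (s ^ (β - t)) with hD
  have hDt : D ≠ ⊤ := lintegral_Ioo_rpow_ne_top (by rw [hβ]; linarith)
  have : IsFiniteMeasure ((volume : Measure (Euc N)).restrict B) := ⟨by
    rw [Measure.restrict_apply_univ]; exact hBt.lt_top⟩
  refine ⟨A * (D * C), ENNReal.mul_ne_top hA (ENNReal.mul_ne_top hDt hC), fun g hg hgt => ?_⟩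
  set W : Euc N → ENNReal := fun h => ENNReal.ofReal (‖h‖ ^ (t - N)) with hW
  have hWm : Measurable W := by fun_prop
  set G : Euc N → ℝ → ENNReal := fun x ρ => ∫⁻ b in B, g (x + ρ • b) with hG
  have hGm : Measurable (Function.uncurry G) := by
    simp only [hG, Function.uncurry_def]
    fun_prop
  set J := ∫⁻ x, ∫⁻ h, W h * G x ‖h‖ ^ r with hJ
  have hscale : ∀ s ∈ Set.Ioo (0 : ℝ) 1, ∀ x,
      ∫⁻ h, W h * G x (s * ‖h‖) ^ r = ENNReal.ofReal (s ^ (-t)) * ∫⁻ h, W h * G x ‖h‖ ^ r := by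
    intro s hs x
    have h0 : 0 < s := hs.1
    have e1 : ∀ h, W h * G x (s * ‖h‖) ^ r =
        ENNReal.ofReal (s ^ (N - t)) * (fun h => W h * G x ‖h‖ ^ r) (s • h) := by
      intro h
      simp only [hW, norm_smul, Real.norm_of_nonneg h0.le]
      rw [← mul_assoc, ← ENNReal.ofReal_mul (by positivity), Real.mul_rpow h0.le (norm_nonneg _),
        ← mul_assoc, ← Real.rpow_add h0]
      simp
    simp_rw [e1]
    rw [lintegral_const_mul' _ _ ENNReal.ofReal_ne_top,
      lintegral_comp_smul_of_pos (fun h => W h * G x ‖h‖ ^ r) h0,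
      ← mul_assoc, ← ENNReal.ofReal_mul (by positivity), ← Real.rpow_add h0]
    congr 3
    ring
  have hm1 : Measurable (fun z : (Euc N × Euc N) × ℝ => G z.1.1 (z.2 * ‖z.1.2‖)) :=
    hGm.comp (f := fun z : (Euc N × Euc N) × ℝ => (z.1.1, z.2 * ‖z.1.2‖)) (by fun_prop)
  have hm2 : Measurable (fun z : (Euc N × Euc N) × ℝ =>
      W z.1.2 * (ENNReal.ofReal (z.2 ^ β) * G z.1.1 (z.2 * ‖z.1.2‖) ^ r)) := by
    fun_prop
  calc _ ≤ ∫⁻ x, ∫⁻ h, W h * (A * ∫⁻ s in Set.Ioo (0 : ℝ) 1,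
          ENNReal.ofReal (s ^ β) * G x (s * ‖h‖) ^ r) := by
        refine lintegral_mono fun x => lintegral_mono fun h => ?_
        refine mul_le_mul_right (HA (fun s => G x (s * ‖h‖)) ?_) _
        exact hm1.comp (g := fun z : (Euc N × Euc N) × ℝ => G z.1.1 (z.2 * ‖z.1.2‖))
          (f := fun s : ℝ => ((x, h), s)) (by fun_prop)
    _ = ∫⁻ x, ∫⁻ h, A * ∫⁻ s in Set.Ioo (0 : ℝ) 1,
          W h * (ENNReal.ofReal (s ^ β) * G x (s * ‖h‖) ^ r) := by
        refine lintegral_congr fun x => lintegral_congr fun h => ?_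
        rw [lintegral_const_mul' _ _ ENNReal.ofReal_ne_top]
        ring
    _ = A * ∫⁻ x, ∫⁻ h, ∫⁻ s in Set.Ioo (0 : ℝ) 1,
          W h * (ENNReal.ofReal (s ^ β) * G x (s * ‖h‖) ^ r) := by
        simp_rw [lintegral_const_mul' _ _ hA]
    _ = A * ∫⁻ x, ∫⁻ s in Set.Ioo (0 : ℝ) 1, ∫⁻ h,
          W h * (ENNReal.ofReal (s ^ β) * G x (s * ‖h‖) ^ r) := by
        congr 1
        refine lintegral_congr fun x => ?_
        rw [lintegral_lintegral_swap]
        exact (hm2.comp (f := fun z : Euc N × ℝ => ((x, z.1), z.2)) (by fun_prop)).aemeasurable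
    _ = A * ∫⁻ s in Set.Ioo (0 : ℝ) 1, ∫⁻ x, ∫⁻ h,
          W h * (ENNReal.ofReal (s ^ β) * G x (s * ‖h‖) ^ r) := by
        congr 1
        rw [lintegral_lintegral_swap]
        refine Measurable.aemeasurable ?_
        exact Measurable.lintegral_prod_right'
          (hm2.comp (f := fun z : (Euc N × ℝ) × Euc N => ((z.1.1, z.2), z.1.2)) (by fun_prop))
    _ = A * ∫⁻ s in Set.Ioo (0 : ℝ) 1, ENNReal.ofReal (s ^ (β - t)) * J := by
        congr 1
        refine setLIntegral_congr_fun measurableSet_Ioo fun s hs => ?_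
        simp_rw [mul_left_comm (W _), lintegral_const_mul' _ _ ENNReal.ofReal_ne_top, hscale s hs,
          lintegral_const_mul' _ _ ENNReal.ofReal_ne_top]
        have h0 : 0 < s := hs.1
        rw [← mul_assoc, ← ENNReal.ofReal_mul (by positivity), ← Real.rpow_add h0, sub_eq_add_neg]
    _ = A * (D * J) := by
        rw [lintegral_mul_const _ (by fun_prop)]
    _ ≤ A * (D * (C * (∫⁻ z, g z ^ p) ^ (r / p))) := by
        gcongr
        exact H g hg hgt
    _ = _ := by ring

/-- A smooth domain satisfies a local interior cone condition, with a cone whose base is a ball of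
radius `2`. -/
theorem IsSmoothDomain.exists_cone {N : ℕ} {Ω : Set (Euc N)} (hΩ : IsSmoothDomain Ω) {x₀ : Euc N}
    (hx₀ : x₀ ∈ closure Ω) :
    ∃ ε > 0, ∃ e : Euc N, ∀ x ∈ Ω ∩ Metric.ball x₀ ε, ∀ b ∈ Metric.ball e 2,
      ∀ s ∈ Set.Icc 0 ε, x + s • b ∈ Ω := by
  obtain ⟨ho, -, f, hf, rfl, hfd⟩ := hΩ
  by_cases hx : x₀ ∈ {x | f x < 0}
  · obtain ⟨δ, hδ, hsub⟩ := Metric.isOpen_iff.1 ho x₀ hx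
    refine ⟨δ / 4, by positivity, 0, fun x hxx b hb s hs => hsub ?_⟩
    have h1 : ‖x - x₀‖ < δ / 4 := by simpa [dist_eq_norm] using hxx.2
    have h2 : ‖b‖ < 2 := by simpa using hb
    rw [Metric.mem_ball, dist_eq_norm]
    calc ‖x + s • b - x₀‖ = ‖(x - x₀) + s • b‖ := by congr 1; abel
      _ ≤ ‖x - x₀‖ + ‖s • b‖ := norm_add_le _ _
      _ < δ := by
        rw [norm_smul, Real.norm_of_nonneg hs.1]
        nlinarith [hs.1, hs.2, norm_nonneg b]
  · have hfr : x₀ ∈ frontier {x | f x < 0} := ⟨hx₀, by rwa [ho.interior_eq]⟩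
    have hd := hfd x₀ hfr
    set L := fderiv ℝ f x₀ with hL
    obtain ⟨v, hv⟩ : ∃ v, L v < 0 := by
      obtain ⟨v, hv⟩ : ∃ v, L v ≠ 0 := by
        by_contra! h
        exact hd (ContinuousLinearMap.ext h)
      rcases lt_or_gt_of_ne hv with h | h
      · exact ⟨v, h⟩
      · exact ⟨-v, by simpa using h⟩
    set κ := (2 * ‖L‖ + 1) / (-L v) with hκ
    set e := κ • v with he
    have hLe : ∀ b ∈ Metric.ball e 2, L b ≤ -1 := by
      intro b hb
      have h1 : ‖b - e‖ < 2 := by simpa [dist_eq_norm] using hb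
      have h2 : L (b - e) ≤ ‖L‖ * 2 :=
        (le_abs_self _).trans ((L.le_opNorm _).trans (by gcongr))
      have h3 : L e = -(2 * ‖L‖ + 1) := by
        have h4 : -L v ≠ 0 := by linarith
        have h5 : κ * (-L v) = 2 * ‖L‖ + 1 := div_mul_cancel₀ _ h4
        rw [he, map_smul, smul_eq_mul]; linarith
      rw [map_sub] at h2
      linarith
    have hst : HasStrictFDerivAt f L x₀ :=
      hf.contDiffAt.hasStrictFDerivAt (by simp)
    have hη : (0 : ℝ) < 1 / (‖e‖ + 2) := by positivity
    have := hst.isLittleO.def hη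
    obtain ⟨δ, hδ, hball⟩ := Metric.eventually_nhds_iff.1 this
    refine ⟨δ / (‖e‖ + 4), by positivity, e, fun x hxx b hb s hs => ?_⟩
    set ε := δ / (‖e‖ + 4) with hε
    have hε0 : 0 < ε := by positivity
    have hεδ : ε * (‖e‖ + 4) = δ := div_mul_cancel₀ _ (by positivity)
    have h1 : ‖x - x₀‖ < ε := by simpa [dist_eq_norm] using hxx.2
    have h2 : ‖b‖ ≤ ‖e‖ + 2 := by
      have h3 : ‖b - e‖ < 2 := by simpa [dist_eq_norm] using hb
      have := norm_add_le (b - e) e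
      rw [sub_add_cancel] at this
      linarith
    have hsb : ‖s • b‖ ≤ s * (‖e‖ + 2) := by
      rw [norm_smul, Real.norm_of_nonneg hs.1]
      exact mul_le_mul_of_nonneg_left h2 hs.1
    have h4 : ‖x + s • b - x₀‖ < δ := by
      have : x + s • b - x₀ = (x - x₀) + s • b := by abel
      rw [this]
      refine (norm_add_le _ _).trans_lt ?_
      nlinarith [hs.2, norm_nonneg e]
    have h5 : ‖x - x₀‖ < δ := by nlinarith [norm_nonneg e]
    have h6 := hball (y := (x + s • b, x)) (by
      rw [Prod.dist_eq, max_lt_iff]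
      simp only [dist_eq_norm]
      exact ⟨h4, h5⟩)
    simp only [add_sub_cancel_left, map_smul, smul_eq_mul] at h6
    have h7 : 1 / (‖e‖ + 2) * ‖s • b‖ ≤ s := by
      rw [div_mul_eq_mul_div, one_mul, div_le_iff₀ (by positivity)]
      exact hsb
    have h8 := (le_abs_self _).trans (h6.trans h7)
    have h9 := mul_le_mul_of_nonneg_left (hLe b hb) hs.1
    have h10 : f x < 0 := hxx.1
    show f (x + s • b) < 0
    linarith

section
variable {N : ℕ} {F : Type*} [NormedAddCommGroup F] [NormedSpace ℝ F]

/-- The norm of the derivative of `v`, extended by zero outside `Ω`. -/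
def gradExt (Ω : Set (Euc N)) (v : Euc N → F) : Euc N → ENNReal :=
  Ω.indicator fun z => ‖fderiv ℝ v z‖ₑ

theorem measurable_gradExt [CompleteSpace F] {Ω : Set (Euc N)} (hΩ : IsOpen Ω) (v : Euc N → F) :
    Measurable (gradExt Ω v) :=
  (measurable_fderiv ℝ v).enorm.indicator hΩ.measurableSet

theorem gradExt_ne_top (Ω : Set (Euc N)) (v : Euc N → F) (x : Euc N) : gradExt Ω v x ≠ ⊤ := by
  unfold gradExt
  by_cases hx : x ∈ Ω <;> simp [hx]

theorem lintegral_gradExt_rpow {Ω : Set (Euc N)} (hΩ : IsOpen Ω) (v : Euc N → F) {p : ℝ}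
    (hp : 0 < p) : ∫⁻ z, gradExt Ω v z ^ p = ∫⁻ z in Ω, ‖fderiv ℝ v z‖ₑ ^ p := by
  rw [← lintegral_indicator hΩ.measurableSet]
  refine lintegral_congr fun z => ?_
  unfold gradExt
  by_cases hx : z ∈ Ω <;> simp [hx, hp]

theorem enorm_sub_le_lintegral_gradExt {Ω : Set (Euc N)} (hΩ : IsOpen Ω) {v : Euc N → F}
    (hv : ContDiffOn ℝ 1 v Ω) {x w : Euc N} (hseg : ∀ s ∈ Set.Icc (0 : ℝ) 1, x + s • w ∈ Ω) :
    ‖v x - v (x + w)‖ₑ ≤ ‖w‖ₑ * ∫⁻ s in Set.Ioo (0 : ℝ) 1, gradExt Ω v (x + s • w) := by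
  have hc : ContDiffOn ℝ 1 (fun s : ℝ => v (x + s • w)) (Set.Icc 0 1) :=
    hv.comp (by fun_prop) hseg
  have h := enorm_sub_le_lintegral_deriv_of_contDiffOn_Icc hc zero_le_one
  simp only [one_smul, zero_smul, add_zero] at h
  rw [← enorm_neg, neg_sub]
  refine h.trans ?_
  rw [← lintegral_const_mul' _ _ enorm_ne_top, ← restrict_Ioo_eq_restrict_Icc]
  refine setLIntegral_mono' measurableSet_Ioo fun s hs => ?_
  have hs' := hseg s (Set.Ioo_subset_Icc_self hs)
  have hd : HasFDerivAt v (fderiv ℝ v (x + s • w)) (x + s • w) :=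
    ((hv.differentiableOn one_ne_zero).differentiableAt (hΩ.mem_nhds hs')).hasFDerivAt
  have hl : HasDerivAt (fun s : ℝ => x + s • w) w s := by
    simpa using ((hasDerivAt_id s).smul_const w).const_add x
  have hdv : deriv (fun s : ℝ => v (x + s • w)) s = fderiv ℝ v (x + s • w) w :=
    (hd.comp_hasDerivAt s hl).deriv
  rw [hdv, gradExt, Set.indicator_of_mem hs', mul_comm]
  exact ContinuousLinearMap.le_opENorm _ _

/-- The average over scales `s ∈ (0, 1)` of the averages of `g` over `x + (s * ρ) • B`. -/
def scaleAvg (e : Euc N) (g : Euc N → ENNReal) (x : Euc N) (ρ : ℝ) : ENNReal :=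
  ∫⁻ s in Set.Ioo (0 : ℝ) 1, ∫⁻ b in Metric.ball e 2, g (x + (s * ρ) • b)

theorem setLIntegral_enorm_sub_le_scaleAvg [CompleteSpace F] {Ω : Set (Euc N)} (hΩ : IsOpen Ω)
    {v : Euc N → F} (hv : ContDiffOn ℝ 1 v Ω) {x e : Euc N} {ρ : ℝ} (hρ : 0 ≤ ρ)
    (hseg : ∀ b ∈ Metric.ball e 2, ∀ s ∈ Set.Icc 0 ρ, x + s • b ∈ Ω) :
    ∫⁻ b in Metric.ball e 2, ‖v x - v (x + ρ • b)‖ₑ ≤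
      ENNReal.ofReal (‖e‖ + 2) * ENNReal.ofReal ρ * scaleAvg e (gradExt Ω v) x ρ := by
  have hg := measurable_gradExt hΩ v
  calc ∫⁻ b in Metric.ball e 2, ‖v x - v (x + ρ • b)‖ₑ
      ≤ ∫⁻ b in Metric.ball e 2, ENNReal.ofReal (‖e‖ + 2) * ENNReal.ofReal ρ *
          ∫⁻ s in Set.Ioo (0 : ℝ) 1, gradExt Ω v (x + (s * ρ) • b) := by
        refine setLIntegral_mono' measurableSet_ball fun b hb => ?_
        have h1 := enorm_sub_le_lintegral_gradExt hΩ hv (x := x) (w := ρ • b) (fun s hs => by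
          rw [smul_smul]
          exact hseg b hb _ ⟨mul_nonneg hs.1 hρ, mul_le_of_le_one_left hρ hs.2⟩)
        simp_rw [smul_smul] at h1
        refine h1.trans ?_
        gcongr
        rw [← ofReal_norm, norm_smul, Real.norm_of_nonneg hρ,
          ← ENNReal.ofReal_mul (by positivity), mul_comm]
        gcongr
        have h3 : ‖b - e‖ < 2 := by simpa [dist_eq_norm] using hb
        have := norm_add_le (b - e) e
        rw [sub_add_cancel] at this
        linarith
    _ = _ := by
        rw [lintegral_const_mul' _ _ (ENNReal.mul_ne_top ENNReal.ofReal_ne_top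
          ENNReal.ofReal_ne_top), lintegral_lintegral_swap, scaleAvg]
        refine Measurable.aemeasurable ?_
        simp only [Function.uncurry_def]
        fun_prop

theorem enorm_sub_le_scaleAvg_add [CompleteSpace F] {Ω : Set (Euc N)} (hΩ : IsOpen Ω)
    {v : Euc N → F} (hv : ContDiffOn ℝ 1 v Ω) {x y e : Euc N}
    (hx : ∀ b ∈ Metric.ball e 2, ∀ s ∈ Set.Icc 0 ‖x - y‖, x + s • b ∈ Ω)
    (hy : ∀ b ∈ Metric.ball e 2, ∀ s ∈ Set.Icc 0 ‖x - y‖, y + s • b ∈ Ω) :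
    volume (Metric.ball e 1) * ‖v x - v y‖ₑ ≤
      ENNReal.ofReal (‖e‖ + 2) * ENNReal.ofReal ‖x - y‖ *
        (scaleAvg e (gradExt Ω v) x ‖x - y‖ + scaleAvg e (gradExt Ω v) y ‖x - y‖) := by
  rcases eq_or_ne x y with rfl | hxy
  · simp
  set ρ := ‖x - y‖ with hρ
  have hρ0 : 0 < ρ := norm_pos_iff.2 (sub_ne_zero.2 hxy)
  have hsub : Metric.ball e 1 ⊆ Metric.ball e 2 := Metric.ball_subset_ball (by norm_num)
  set ω : Euc N := ρ⁻¹ • (x - y) with hω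
  have hω1 : ‖ω‖ = 1 := by
    rw [hω, norm_smul, norm_inv, norm_norm, inv_mul_cancel₀ hρ0.ne']
  have hωρ : ∀ b, x + ρ • b = y + ρ • (b + ω) := by
    intro b
    rw [hω, smul_add, smul_smul, mul_inv_cancel₀ hρ0.ne', one_smul]
    abel
  have hcont : ContinuousOn (fun b => ‖v x - v (x + ρ • b)‖ₑ) (Metric.ball e 1) := by
    refine ContinuousOn.enorm (continuousOn_const.sub ?_)
    exact hv.continuousOn.comp (by fun_prop)
      (fun b hb => hx b (hsub hb) ρ ⟨hρ0.le, le_rfl⟩)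
  calc volume (Metric.ball e 1) * ‖v x - v y‖ₑ
      = ∫⁻ b in Metric.ball e 1, ‖v x - v y‖ₑ := by rw [setLIntegral_const, mul_comm]
    _ ≤ ∫⁻ b in Metric.ball e 1, (‖v x - v (x + ρ • b)‖ₑ + ‖v y - v (x + ρ • b)‖ₑ) := by
        refine lintegral_mono fun b => ?_
        simp only [← edist_eq_enorm_sub]
        exact edist_triangle_right _ _ _
    _ = (∫⁻ b in Metric.ball e 1, ‖v x - v (x + ρ • b)‖ₑ) +
          ∫⁻ b in Metric.ball e 1, ‖v y - v (x + ρ • b)‖ₑ :=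
        lintegral_add_left' (hcont.aemeasurable measurableSet_ball) _
    _ ≤ (∫⁻ b in Metric.ball e 2, ‖v x - v (x + ρ • b)‖ₑ) +
          ∫⁻ b in Metric.ball e 2, ‖v y - v (y + ρ • b)‖ₑ := by
        gcongr ?_ + ?_
        · exact lintegral_mono_set hsub
        · rw [← lintegral_indicator measurableSet_ball, ← lintegral_indicator measurableSet_ball,
            ← lintegral_add_right_eq_self
              ((Metric.ball e 2).indicator fun b => ‖v y - v (y + ρ • b)‖ₑ) ω]
          refine lintegral_mono fun b => ?_
          by_cases hb : b ∈ Metric.ball e 1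
          · have hb' : b + ω ∈ Metric.ball e 2 := by
              rw [Metric.mem_ball, dist_eq_norm] at hb ⊢
              have := norm_add_le (b - e) ω
              have e1 : b + ω - e = b - e + ω := by abel
              rw [e1]; linarith
            rw [Set.indicator_of_mem hb, Set.indicator_of_mem hb', hωρ]
          · rw [Set.indicator_of_notMem hb]; exact zero_le
    _ ≤ _ := by
        rw [mul_add]
        gcongr
        · exact setLIntegral_enorm_sub_le_scaleAvg hΩ hv hρ0.le hx
        · exact setLIntegral_enorm_sub_le_scaleAvg hΩ hv hρ0.le hy

end

/-- The integrand of the Gagliardo seminorm of order `1 - t / r`. -/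
def gagKernel {N : ℕ} {F : Type*} [NormedAddCommGroup F] (t r : ℝ) (v : Euc N → F)
    (z : Euc N × Euc N) : ENNReal :=
  ‖v z.1 - v z.2‖ₑ ^ r * ENNReal.ofReal (‖z.1 - z.2‖ ^ (-(N + r - t)))

section
variable {N : ℕ}

theorem ContinuousOn.aemeasurable_gagKernel {F : Type*} [NormedAddCommGroup F] {t r : ℝ}
    {v : Euc N → F} {S : Set (Euc N)} (hS : MeasurableSet S) (hv : ContinuousOn v S) :
    AEMeasurable (gagKernel t r v) (volume.restrict (S ×ˢ S)) := by
  unfold gagKernel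
  refine AEMeasurable.mul (AEMeasurable.pow_const ?_ _) (Measurable.aemeasurable (by fun_prop))
  refine ContinuousOn.aemeasurable (ContinuousOn.enorm (ContinuousOn.sub ?_ ?_)) (hS.prod hS)
  · exact hv.comp continuousOn_fst fun z hz => hz.1
  · exact hv.comp continuousOn_snd fun z hz => hz.2

theorem lintegral_gagKernel_eq {F : Type*} [NormedAddCommGroup F] {t r : ℝ}
    {v : Euc N → F} {S : Set (Euc N)} (hS : MeasurableSet S) (hv : ContinuousOn v S) :
    ∫⁻ z in S ×ˢ S, gagKernel t r v z = ∫⁻ x in S, ∫⁻ y in S, gagKernel t r v (x, y) := by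
  have h := hv.aemeasurable_gagKernel (t := t) (r := r) hS
  rw [Measure.volume_eq_prod, ← Measure.prod_restrict] at h ⊢
  exact lintegral_prod _ h

theorem measurable_scaleAvg (e : Euc N) {g : Euc N → ENNReal} (hg : Measurable g) :
    Measurable (Function.uncurry (scaleAvg e g)) := by
  simp only [Function.uncurry_def, scaleAvg]
  fun_prop

theorem gagKernel_le {F : Type*} [NormedAddCommGroup F] {t r : ℝ} (hr : 1 < r)
    {v : Euc N → F} {x y : Euc N} {c a b : ENNReal}
    (h : ‖v x - v y‖ₑ ≤ c * ENNReal.ofReal ‖x - y‖ * (a + b)) :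
    gagKernel t r v (x, y) ≤ c ^ r * 2 ^ (r - 1) *
      (ENNReal.ofReal (‖x - y‖ ^ (t - N)) * a ^ r + ENNReal.ofReal (‖x - y‖ ^ (t - N)) * b ^ r) := by
  have hr0 : 0 < r := by linarith
  rcases eq_or_ne x y with rfl | hxy
  · simp [gagKernel, hr0]
  have hρ : 0 < ‖x - y‖ := norm_pos_iff.2 (sub_ne_zero.2 hxy)
  unfold gagKernel
  simp only
  calc _ ≤ (c * ENNReal.ofReal ‖x - y‖ * (a + b)) ^ r *
          ENNReal.ofReal (‖x - y‖ ^ (-(N + r - t))) := by gcongr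
    _ = c ^ r * (a + b) ^ r * ENNReal.ofReal (‖x - y‖ ^ (t - N)) := by
        rw [ENNReal.mul_rpow_of_nonneg _ _ hr0.le, ENNReal.mul_rpow_of_nonneg _ _ hr0.le,
          ENNReal.ofReal_rpow_of_pos hρ]
        have : ENNReal.ofReal (‖x - y‖ ^ (t - N)) = ENNReal.ofReal (‖x - y‖ ^ r) *
            ENNReal.ofReal (‖x - y‖ ^ (-(N + r - t))) := by
          rw [← ENNReal.ofReal_mul (by positivity), ← Real.rpow_add hρ]
          congr 2; ring
        rw [this]; ring
    _ ≤ c ^ r * (2 ^ (r - 1) * (a ^ r + b ^ r)) * ENNReal.ofReal (‖x - y‖ ^ (t - N)) := by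
        gcongr
        exact ENNReal.rpow_add_le_mul_rpow_add_rpow a b hr.le
    _ = _ := by ring

theorem lintegral_lintegral_weight_scaleAvg (e : Euc N) {g : Euc N → ENNReal}
    (hg : Measurable g) (t r : ℝ) :
    ∫⁻ x, ∫⁻ y, (ENNReal.ofReal (‖x - y‖ ^ (t - N)) * scaleAvg e g x ‖x - y‖ ^ r +
        ENNReal.ofReal (‖x - y‖ ^ (t - N)) * scaleAvg e g y ‖x - y‖ ^ r) =
      2 * ∫⁻ x, ∫⁻ h : Euc N, ENNReal.ofReal (‖h‖ ^ (t - N)) * scaleAvg e g x ‖h‖ ^ r := by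
  have hm := measurable_scaleAvg e hg
  have hm1 : Measurable (fun z : Euc N × Euc N =>
      ENNReal.ofReal (‖z.1 - z.2‖ ^ (t - N)) * scaleAvg e g z.1 ‖z.1 - z.2‖ ^ r) := by
    have := hm.comp (f := fun z : Euc N × Euc N => (z.1, ‖z.1 - z.2‖)) (by fun_prop)
    simp only [Function.comp_def, Function.uncurry_def] at this
    fun_prop
  have hm2 : Measurable (fun z : Euc N × Euc N =>
      ENNReal.ofReal (‖z.1 - z.2‖ ^ (t - N)) * scaleAvg e g z.2 ‖z.1 - z.2‖ ^ r) := by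
    have := hm.comp (f := fun z : Euc N × Euc N => (z.2, ‖z.1 - z.2‖)) (by fun_prop)
    simp only [Function.comp_def, Function.uncurry_def] at this
    fun_prop
  have e1 : ∫⁻ x, ∫⁻ y, ENNReal.ofReal (‖x - y‖ ^ (t - N)) * scaleAvg e g x ‖x - y‖ ^ r =
      ∫⁻ x, ∫⁻ h : Euc N, ENNReal.ofReal (‖h‖ ^ (t - N)) * scaleAvg e g x ‖h‖ ^ r := by
    refine lintegral_congr fun x => ?_
    exact lintegral_sub_left_eq_self
      (fun h : Euc N => ENNReal.ofReal (‖h‖ ^ (t - N)) * scaleAvg e g x ‖h‖ ^ r) x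
  have e2 : ∫⁻ x, ∫⁻ y, ENNReal.ofReal (‖x - y‖ ^ (t - N)) * scaleAvg e g y ‖x - y‖ ^ r =
      ∫⁻ x, ∫⁻ y, ENNReal.ofReal (‖x - y‖ ^ (t - N)) * scaleAvg e g x ‖x - y‖ ^ r := by
    rw [lintegral_lintegral_swap hm2.aemeasurable]
    exact lintegral_congr fun x => lintegral_congr fun y => by rw [norm_sub_rev]
  have e3 : ∀ x, ∫⁻ y, (ENNReal.ofReal (‖x - y‖ ^ (t - N)) * scaleAvg e g x ‖x - y‖ ^ r +
        ENNReal.ofReal (‖x - y‖ ^ (t - N)) * scaleAvg e g y ‖x - y‖ ^ r) =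
      (∫⁻ y, ENNReal.ofReal (‖x - y‖ ^ (t - N)) * scaleAvg e g x ‖x - y‖ ^ r) +
      ∫⁻ y, ENNReal.ofReal (‖x - y‖ ^ (t - N)) * scaleAvg e g y ‖x - y‖ ^ r := fun x =>
    lintegral_add_left (hm1.comp (f := fun y => (x, y)) (by fun_prop)) _
  simp_rw [e3]
  rw [lintegral_add_left hm1.lintegral_prod_right', e2, e1, two_mul]

theorem IsSmoothDomain.exists_local_gagKernel_le {Ω : Set (Euc N)} (hΩ : IsSmoothDomain Ω)
    (hN : 1 ≤ N) {t r p : ℝ} (ht : 0 < t) (htN : t < N)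
    (hr : 1 < r) (htr : t < r) (hp1 : 1 < p) (hpr : p * (N + t) = N * r)
    {x₀ : Euc N} (hx₀ : x₀ ∈ closure Ω) :
    ∃ δ > 0, ∃ C : ENNReal, C ≠ ⊤ ∧ ∀ (F : Type) [NormedAddCommGroup F] [NormedSpace ℝ F]
      [CompleteSpace F] (v : Euc N → F), ContDiffOn ℝ 1 v Ω →
      ∫⁻ z in (Ω ∩ Metric.ball x₀ δ) ×ˢ (Ω ∩ Metric.ball x₀ δ), gagKernel t r v z ≤
        C * (∫⁻ z in Ω, ‖fderiv ℝ v z‖ₑ ^ p) ^ (r / p) := by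
  obtain ⟨ε, hε, e, he⟩ := hΩ.exists_cone hx₀
  have hr0 : 0 < r := by linarith
  obtain ⟨C, hC, H⟩ := exists_lintegral_scale_average_le hN (B := Metric.ball e 2)
    (Metric.measure_ball_pos volume e two_pos).ne' measure_ball_lt_top.ne ht htN hr htr hp1 hpr
  have hV0 := (Metric.measure_ball_pos volume e one_pos).ne'
  have hVt := (measure_ball_lt_top (μ := (volume : Measure (Euc N))) (x := e) (r := 1)).ne
  set c := (volume (Metric.ball e 1))⁻¹ * ENNReal.ofReal (‖e‖ + 2) with hc
  have hct : c ≠ ⊤ := ENNReal.mul_ne_top (by simpa using hV0) ENNReal.ofReal_ne_top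
  have hK : c ^ r * 2 ^ (r - 1) ≠ ⊤ := ENNReal.mul_ne_top
    (ENNReal.rpow_ne_top_of_nonneg hr0.le hct)
    (ENNReal.rpow_ne_top_of_nonneg (by linarith) (by simp))
  refine ⟨ε / 2, by positivity, c ^ r * 2 ^ (r - 1) * (2 * C),
    ENNReal.mul_ne_top hK (ENNReal.mul_ne_top (by simp) hC), fun F _ _ _ v hv => ?_⟩
  set S := Ω ∩ Metric.ball x₀ (ε / 2) with hS
  have hSo : IsOpen S := hΩ.1.inter Metric.isOpen_ball
  have hg := measurable_gradExt hΩ.1 v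
  rw [lintegral_gagKernel_eq hSo.measurableSet (hv.continuousOn.mono Set.inter_subset_left)]
  have hpt : ∀ x ∈ S, ∀ y ∈ S, gagKernel t r v (x, y) ≤ c ^ r * 2 ^ (r - 1) *
      (ENNReal.ofReal (‖x - y‖ ^ (t - N)) * scaleAvg e (gradExt Ω v) x ‖x - y‖ ^ r +
        ENNReal.ofReal (‖x - y‖ ^ (t - N)) * scaleAvg e (gradExt Ω v) y ‖x - y‖ ^ r) := by
    intro x hx y hy
    have hxy : ‖x - y‖ ≤ ε := by
      rw [← dist_eq_norm]
      refine (dist_triangle_right x y x₀).trans ?_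
      have h1 := Metric.mem_ball.1 hx.2
      have h2 := Metric.mem_ball.1 hy.2
      linarith
    have hsub : Metric.ball x₀ (ε / 2) ⊆ Metric.ball x₀ ε :=
      Metric.ball_subset_ball (by linarith)
    have h := enorm_sub_le_scaleAvg_add hΩ.1 hv (x := x) (y := y) (e := e)
      (fun b hb s hs => he x ⟨hx.1, hsub hx.2⟩ b hb s ⟨hs.1, hs.2.trans hxy⟩)
      (fun b hb s hs => he y ⟨hy.1, hsub hy.2⟩ b hb s ⟨hs.1, hs.2.trans hxy⟩)
    refine gagKernel_le hr ?_
    rw [hc, mul_assoc, mul_assoc, ← mul_assoc (ENNReal.ofReal _), ← ENNReal.div_eq_inv_mul,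
      ENNReal.le_div_iff_mul_le (Or.inl hV0) (Or.inl hVt), mul_comm]
    exact h
  calc _ ≤ ∫⁻ x in S, ∫⁻ y in S, c ^ r * 2 ^ (r - 1) *
      (ENNReal.ofReal (‖x - y‖ ^ (t - N)) * scaleAvg e (gradExt Ω v) x ‖x - y‖ ^ r +
        ENNReal.ofReal (‖x - y‖ ^ (t - N)) * scaleAvg e (gradExt Ω v) y ‖x - y‖ ^ r) :=
        setLIntegral_mono' hSo.measurableSet fun x hx =>
          setLIntegral_mono' hSo.measurableSet fun y hy => hpt x hx y hy
    _ ≤ ∫⁻ x, ∫⁻ y, c ^ r * 2 ^ (r - 1) *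
      (ENNReal.ofReal (‖x - y‖ ^ (t - N)) * scaleAvg e (gradExt Ω v) x ‖x - y‖ ^ r +
        ENNReal.ofReal (‖x - y‖ ^ (t - N)) * scaleAvg e (gradExt Ω v) y ‖x - y‖ ^ r) :=
        (setLIntegral_le_lintegral _ _).trans
          (lintegral_mono fun x => setLIntegral_le_lintegral _ _)
    _ = c ^ r * 2 ^ (r - 1) * (2 * ∫⁻ x, ∫⁻ h : Euc N, ENNReal.ofReal (‖h‖ ^ (t - N)) *
          scaleAvg e (gradExt Ω v) x ‖h‖ ^ r) := by
        simp_rw [lintegral_const_mul' _ _ hK]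
        rw [lintegral_lintegral_weight_scaleAvg e hg]
    _ ≤ c ^ r * 2 ^ (r - 1) * (2 * (C * (∫⁻ z, gradExt Ω v z ^ p) ^ (r / p))) := by
        gcongr
        exact H _ hg (gradExt_ne_top Ω v)
    _ = _ := by
        rw [lintegral_gradExt_rpow hΩ.1 v (by linarith)]
        ring

end

section
variable {N : ℕ} {F : Type*} [NormedAddCommGroup F]

theorem enorm_sub_rpow_le_mul_gagKernel {t r D : ℝ} (hr : 0 < r) (ha : 0 ≤ N + r - t)
    (v : Euc N → F) {x y : Euc N} (h : ‖x - y‖ ≤ D) :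
    ‖v x - v y‖ₑ ^ r ≤ ENNReal.ofReal (D ^ (N + r - t)) * gagKernel t r v (x, y) := by
  rcases eq_or_ne x y with rfl | hxy
  · simp [hr]
  have hρ : 0 < ‖x - y‖ := norm_pos_iff.2 (sub_ne_zero.2 hxy)
  have h1 : 1 ≤ ENNReal.ofReal (D ^ (N + r - t)) * ENNReal.ofReal (‖x - y‖ ^ (-(N + r - t))) := by
    rw [← ENNReal.ofReal_mul (Real.rpow_nonneg (hρ.le.trans h) _), ENNReal.one_le_ofReal,
      Real.rpow_neg hρ.le, ← div_eq_mul_inv, one_le_div (Real.rpow_pos_of_pos hρ _)]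
    exact Real.rpow_le_rpow hρ.le h ha
  calc _ = ‖v x - v y‖ₑ ^ r * 1 := (mul_one _).symm
    _ ≤ ‖v x - v y‖ₑ ^ r * (ENNReal.ofReal (D ^ (N + r - t)) *
        ENNReal.ofReal (‖x - y‖ ^ (-(N + r - t)))) := by gcongr
    _ = _ := by simp only [gagKernel]; ring

theorem gagKernel_le_of_le {t r δ : ℝ} (hr : 1 ≤ r) (ha : 0 ≤ N + r - t) (hδ : 0 < δ)
    (v : Euc N → F) {x y : Euc N} (h : δ ≤ ‖x - y‖) :
    gagKernel t r v (x, y) ≤ ENNReal.ofReal (δ ^ (-(N + r - t))) * 2 ^ (r - 1) *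
      (‖v x‖ₑ ^ r + ‖v y‖ₑ ^ r) := by
  have h1 : ‖v x - v y‖ₑ ^ r ≤ 2 ^ (r - 1) * (‖v x‖ₑ ^ r + ‖v y‖ₑ ^ r) := by
    refine (ENNReal.rpow_le_rpow enorm_sub_le (by linarith)).trans ?_
    exact ENNReal.rpow_add_le_mul_rpow_add_rpow _ _ hr
  have h2 : ‖x - y‖ ^ (-(N + r - t)) ≤ δ ^ (-(N + r - t)) :=
    Real.rpow_le_rpow_of_nonpos hδ h (by linarith)
  calc gagKernel t r v (x, y) ≤ 2 ^ (r - 1) * (‖v x‖ₑ ^ r + ‖v y‖ₑ ^ r) *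
        ENNReal.ofReal (δ ^ (-(N + r - t))) := by
        unfold gagKernel; gcongr
    _ = _ := by ring

theorem exists_setLIntegral_rpow_le {t r p D : ℝ} (hr : 1 < r) (ha : 0 ≤ N + r - t) (hp : 1 ≤ p)
    {S : Set (Euc N)} (hS : MeasurableSet S) (h0 : volume S ≠ 0) (hfin : volume S ≠ ⊤)
    (hD : ∀ x ∈ S, ∀ y ∈ S, ‖x - y‖ ≤ D) :
    ∃ C : ENNReal, C ≠ ⊤ ∧ ∀ (F : Type) [NormedAddCommGroup F] (v : Euc N → F),
      ContinuousOn v S → ∫⁻ x in S, ‖v x‖ₑ ^ r ≤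
        C * ((∫⁻ z in S ×ˢ S, gagKernel t r v z) + (∫⁻ x in S, ‖v x‖ₑ ^ p) ^ (r / p)) := by
  have hr0 : 0 < r := by linarith
  have hp0 : 0 < p := by linarith
  set V := volume S with hV
  set A := V ^ (r - 1) * ENNReal.ofReal (D ^ (N + r - t)) with hA
  set B := V * (V ^ (p - 1)) ^ (r / p) with hB
  have hAt : A ≠ ⊤ := ENNReal.mul_ne_top
    (ENNReal.rpow_ne_top_of_nonneg (by linarith) hfin) ENNReal.ofReal_ne_top
  have hBt : B ≠ ⊤ := ENNReal.mul_ne_top hfin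
    (ENNReal.rpow_ne_top_of_nonneg (by positivity)
      (ENNReal.rpow_ne_top_of_nonneg (by linarith) hfin))
  have hVr0 : V ^ r ≠ 0 := by simp [ENNReal.rpow_eq_zero_iff, h0, hr0.le]
  have hVrt : V ^ r ≠ ⊤ := ENNReal.rpow_ne_top_of_nonneg hr0.le hfin
  have h2t : (2 : ENNReal) ^ (r - 1) ≠ ⊤ :=
    ENNReal.rpow_ne_top_of_nonneg (by linarith) (by simp)
  refine ⟨(V ^ r)⁻¹ * (2 ^ (r - 1) * (A + B)), ENNReal.mul_ne_top (by simpa using hVr0)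
    (ENNReal.mul_ne_top h2t (by simp [hAt, hBt])), fun F _ v hv => ?_⟩
  set P := ∫⁻ x in S, ‖v x‖ₑ ^ p with hP
  have hn : AEMeasurable (fun y => ‖v y‖ₑ) (volume.restrict S) := hv.enorm.aemeasurable hS
  have hn1 : (∫⁻ y in S, ‖v y‖ₑ) ^ r ≤ (V ^ (p - 1)) ^ (r / p) * P ^ (r / p) := by
    have h := lintegral_rpow_le_mul_lintegral_rpow hp hn
    rw [Measure.restrict_apply_univ] at h
    have := ENNReal.rpow_le_rpow h (show 0 ≤ r / p by positivity)
    rwa [← ENNReal.rpow_mul, mul_div_cancel₀ _ hp0.ne',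
      ENNReal.mul_rpow_of_nonneg _ _ (by positivity)] at this
  have hpt : ∀ x ∈ S, V ^ r * ‖v x‖ₑ ^ r ≤ 2 ^ (r - 1) *
      (A * (∫⁻ y in S, gagKernel t r v (x, y)) + (V ^ (p - 1)) ^ (r / p) * P ^ (r / p)) := by
    intro x hx
    have hd : AEMeasurable (fun y => ‖v x - v y‖ₑ) (volume.restrict S) :=
      (continuousOn_const.sub hv).enorm.aemeasurable hS
    have h1 : V * ‖v x‖ₑ ≤ (∫⁻ y in S, ‖v x - v y‖ₑ) + ∫⁻ y in S, ‖v y‖ₑ := by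
      rw [← lintegral_add_left' hd, mul_comm, hV, ← setLIntegral_const]
      refine lintegral_mono fun y => ?_
      calc ‖v x‖ₑ = ‖(v x - v y) + v y‖ₑ := by rw [sub_add_cancel]
        _ ≤ _ := enorm_add_le _ _
    have h2 : (∫⁻ y in S, ‖v x - v y‖ₑ) ^ r ≤ A * ∫⁻ y in S, gagKernel t r v (x, y) := by
      have h := lintegral_rpow_le_mul_lintegral_rpow hr.le hd
      rw [Measure.restrict_apply_univ] at h
      refine h.trans ?_
      rw [hA, mul_assoc, ← lintegral_const_mul' _ _ ENNReal.ofReal_ne_top]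
      gcongr 1
      exact setLIntegral_mono' hS fun y hy =>
        enorm_sub_rpow_le_mul_gagKernel hr0 ha v (hD x hx y hy)
    calc V ^ r * ‖v x‖ₑ ^ r = (V * ‖v x‖ₑ) ^ r := (ENNReal.mul_rpow_of_nonneg _ _ hr0.le).symm
      _ ≤ ((∫⁻ y in S, ‖v x - v y‖ₑ) + ∫⁻ y in S, ‖v y‖ₑ) ^ r := by gcongr
      _ ≤ 2 ^ (r - 1) * ((∫⁻ y in S, ‖v x - v y‖ₑ) ^ r + (∫⁻ y in S, ‖v y‖ₑ) ^ r) :=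
        ENNReal.rpow_add_le_mul_rpow_add_rpow _ _ hr.le
      _ ≤ _ := by gcongr
  have hintg : V ^ r * ∫⁻ x in S, ‖v x‖ₑ ^ r ≤ 2 ^ (r - 1) *
      (A * (∫⁻ z in S ×ˢ S, gagKernel t r v z) + B * P ^ (r / p)) := by
    rw [← lintegral_const_mul' _ _ hVrt]
    refine (setLIntegral_mono' hS hpt).trans ?_
    rw [lintegral_const_mul' _ _ h2t, lintegral_add_right _ measurable_const,
      lintegral_const_mul' _ _ hAt, setLIntegral_const, lintegral_gagKernel_eq hS hv, hB]
    apply le_of_eq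
    ring
  have h3 : ∫⁻ x in S, ‖v x‖ₑ ^ r = (V ^ r)⁻¹ * (V ^ r * ∫⁻ x in S, ‖v x‖ₑ ^ r) := by
    rw [← mul_assoc, ENNReal.inv_mul_cancel hVr0 hVrt, one_mul]
  rw [h3]
  calc _ ≤ (V ^ r)⁻¹ * (2 ^ (r - 1) *
      (A * (∫⁻ z in S ×ˢ S, gagKernel t r v z) + B * P ^ (r / p))) := by gcongr
    _ ≤ (V ^ r)⁻¹ * (2 ^ (r - 1) * ((A + B) * (∫⁻ z in S ×ˢ S, gagKernel t r v z) +
        (A + B) * P ^ (r / p))) := by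
        gcongr
        · exact le_self_add
        · exact le_add_self
    _ = _ := by ring

theorem setLIntegral_prod_add_eq {f : Euc N → ENNReal} {S : Set (Euc N)}
    (hf : AEMeasurable f (volume.restrict S)) :
    ∫⁻ z in S ×ˢ S, (f z.1 + f z.2) = 2 * volume S * ∫⁻ x in S, f x := by
  have h1 : AEMeasurable (fun z : Euc N × Euc N => f z.1)
      ((volume.restrict S).prod (volume.restrict S)) := hf.comp_fst
  have h2 : AEMeasurable (fun z : Euc N × Euc N => f z.2)
      ((volume.restrict S).prod (volume.restrict S)) := hf.comp_snd
  rw [Measure.volume_eq_prod, ← Measure.prod_restrict, lintegral_add_left' h1,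
    lintegral_prod _ h1, lintegral_prod _ h2]
  simp only [lintegral_const, Measure.restrict_apply_univ]
  rw [lintegral_mul_const'' _ hf]
  ring

theorem exists_global_gagKernel_le {Ω : Set (Euc N)} (hΩ : IsSmoothDomain Ω)
    (hN : 1 ≤ N) {t r p : ℝ} (ht : 0 < t) (htN : t < N)
    (hr : 1 < r) (htr : t < r) (hp1 : 1 < p) (hpr : p * (N + t) = N * r) :
    ∃ C : ENNReal, C ≠ ⊤ ∧ ∀ (F : Type) [NormedAddCommGroup F] [NormedSpace ℝ F]
      [CompleteSpace F] (v : Euc N → F), ContDiffOn ℝ 1 v Ω →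
      (∫⁻ x in Ω, ‖v x‖ₑ ^ r) + ∫⁻ z in Ω ×ˢ Ω, gagKernel t r v z ≤
        C * ((∫⁻ x in Ω, ‖v x‖ₑ ^ p) ^ (r / p) +
          (∫⁻ x in Ω, ‖fderiv ℝ v x‖ₑ ^ p) ^ (r / p)) := by
  have hr0 : 0 < r := by linarith
  have hp0 : 0 < p := by linarith
  have ha : 0 ≤ N + r - t := by linarith
  have hΩfin : volume Ω ≠ ⊤ := hΩ.2.1.measure_lt_top.ne
  have hΩm : MeasurableSet Ω := hΩ.1.measurableSet
  obtain ⟨D, hD⟩ := Metric.isBounded_iff.1 hΩ.2.1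
  have hloc : ∀ x₀ ∈ closure Ω, ∃ δ > 0, ∃ C : ENNReal, C ≠ ⊤ ∧
      ∀ (F : Type) [NormedAddCommGroup F] [NormedSpace ℝ F]
      [CompleteSpace F] (v : Euc N → F), ContDiffOn ℝ 1 v Ω →
      (∫⁻ x in Ω ∩ Metric.ball x₀ δ, ‖v x‖ₑ ^ r) +
      ∫⁻ z in (Ω ∩ Metric.ball x₀ δ) ×ˢ (Ω ∩ Metric.ball x₀ δ), gagKernel t r v z ≤
        C * ((∫⁻ x in Ω, ‖v x‖ₑ ^ p) ^ (r / p) +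
          (∫⁻ x in Ω, ‖fderiv ℝ v x‖ₑ ^ p) ^ (r / p)) := by
    intro x₀ hx₀
    obtain ⟨δ, hδ, C, hC, H⟩ := hΩ.exists_local_gagKernel_le hN ht htN hr htr hp1 hpr hx₀
    have hSo : IsOpen (Ω ∩ Metric.ball x₀ δ) := hΩ.1.inter Metric.isOpen_ball
    have hne : (Ω ∩ Metric.ball x₀ δ).Nonempty := by
      obtain ⟨y, hy, hd⟩ := Metric.mem_closure_iff.1 hx₀ δ hδ
      exact ⟨y, hy, by rwa [Metric.mem_ball, dist_comm]⟩
    obtain ⟨C', hC', H'⟩ := exists_setLIntegral_rpow_le (t := t) (D := D) hr ha hp1.le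
      hSo.measurableSet (hSo.measure_pos volume hne).ne'
      (ne_top_of_le_ne_top hΩfin (measure_mono Set.inter_subset_left))
      (fun x hx y hy => by rw [← dist_eq_norm]; exact hD hx.1 hy.1)
    refine ⟨δ, hδ, C' * (C + 1) + C, by finiteness, fun F _ _ _ v hv => ?_⟩
    have h1 := H F v hv
    have h2 := H' F v (hv.continuousOn.mono Set.inter_subset_left)
    have h3 : (∫⁻ x in Ω ∩ Metric.ball x₀ δ, ‖v x‖ₑ ^ p) ^ (r / p) ≤
        (∫⁻ x in Ω, ‖v x‖ₑ ^ p) ^ (r / p) :=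
      ENNReal.rpow_le_rpow (lintegral_mono_set Set.inter_subset_left) (by positivity)
    set X := (∫⁻ x in Ω, ‖v x‖ₑ ^ p) ^ (r / p)
    set Y := (∫⁻ x in Ω, ‖fderiv ℝ v x‖ₑ ^ p) ^ (r / p)
    calc _ ≤ C' * (C * Y + X) + C * Y := by
          refine add_le_add (h2.trans ?_) h1
          gcongr
      _ ≤ C' * (C * (X + Y) + 1 * (X + Y)) + C * (X + Y) := by
          rw [one_mul]
          gcongr
          · exact le_add_self
          · exact le_self_add
          · exact le_add_self
      _ = _ := by ring
  choose! δ hδ C hC H using hloc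
  have hcomp : IsCompact (closure Ω) := hΩ.2.1.isCompact_closure
  obtain ⟨s, hs, hcov⟩ := hcomp.elim_nhds_subcover (fun x => Metric.ball x (δ x))
    fun x hx => Metric.ball_mem_nhds x (hδ x hx)
  obtain ⟨ε, hε, hleb⟩ := lebesgue_number_lemma_of_metric (ι := s)
    (c := fun i => Metric.ball (i : Euc N) (δ i)) hcomp (fun i => Metric.isOpen_ball)
    (by simpa [Set.iUnion_subtype] using hcov)
  set K := ∑ i : s, C i with hK
  have hKt : K ≠ ⊤ := ENNReal.sum_ne_top.2 fun i _ => hC i (hs i i.2)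
  set A := ENNReal.ofReal (ε ^ (-(N + r - t))) * 2 ^ (r - 1) with hA
  have hAt : A ≠ ⊤ := ENNReal.mul_ne_top ENNReal.ofReal_ne_top
    (ENNReal.rpow_ne_top_of_nonneg (by linarith) (by simp))
  refine ⟨K + (K + A * (2 * volume Ω * K)), by finiteness, fun F _ _ _ v hv => ?_⟩
  set S : s → Set (Euc N) := fun i => Ω ∩ Metric.ball (i : Euc N) (δ i) with hS
  set X := (∫⁻ x in Ω, ‖v x‖ₑ ^ p) ^ (r / p)
  set Y := (∫⁻ x in Ω, ‖fderiv ℝ v x‖ₑ ^ p) ^ (r / p)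
  have hsum : ∑ i : s, C i * (X + Y) = K * (X + Y) := by rw [hK, Finset.sum_mul]
  have h1 : ∫⁻ x in Ω, ‖v x‖ₑ ^ r ≤ K * (X + Y) := by
    have hsub : Ω ⊆ ⋃ i, S i := fun x hx => by
      obtain ⟨i, hi⟩ := hleb x (subset_closure hx)
      exact Set.mem_iUnion.2 ⟨i, hx, hi (Metric.mem_ball_self hε)⟩
    refine (lintegral_mono_set hsub).trans ((lintegral_iUnion_le _ _).trans ?_)
    rw [tsum_fintype, ← hsum]
    exact Finset.sum_le_sum fun i _ => le_self_add.trans (H i (hs i i.2) F v hv)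
  set T := (Ω ×ˢ Ω) ∩ {z : Euc N × Euc N | ε ≤ ‖z.1 - z.2‖} with hT
  have hTm : MeasurableSet T :=
    (hΩm.prod hΩm).inter (measurableSet_le measurable_const (by fun_prop))
  have h2 : ∫⁻ z in T, gagKernel t r v z ≤ A * (2 * volume Ω * (K * (X + Y))) := by
    calc ∫⁻ z in T, gagKernel t r v z ≤ ∫⁻ z in T, A * (‖v z.1‖ₑ ^ r + ‖v z.2‖ₑ ^ r) :=
          setLIntegral_mono' hTm fun z hz => gagKernel_le_of_le hr.le ha hε v hz.2
      _ ≤ ∫⁻ z in Ω ×ˢ Ω, A * (‖v z.1‖ₑ ^ r + ‖v z.2‖ₑ ^ r) :=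
          lintegral_mono_set Set.inter_subset_left
      _ = A * (2 * volume Ω * ∫⁻ x in Ω, ‖v x‖ₑ ^ r) := by
          rw [lintegral_const_mul' _ _ hAt, setLIntegral_prod_add_eq
            ((hv.continuousOn.enorm.aemeasurable hΩm).pow_const r)]
      _ ≤ _ := by gcongr
  have h3 : ∫⁻ z in Ω ×ˢ Ω, gagKernel t r v z ≤
      K * (X + Y) + A * (2 * volume Ω * (K * (X + Y))) := by
    have hsub : Ω ×ˢ Ω ⊆ (⋃ i, S i ×ˢ S i) ∪ T := fun z hz => by
      rcases le_or_gt ε ‖z.1 - z.2‖ with h | h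
      · exact Or.inr ⟨hz, h⟩
      · obtain ⟨i, hi⟩ := hleb z.1 (subset_closure hz.1)
        refine Or.inl (Set.mem_iUnion.2 ⟨i, ⟨hz.1, hi (Metric.mem_ball_self hε)⟩,
          hz.2, hi ?_⟩)
        rwa [Metric.mem_ball, dist_comm, dist_eq_norm]
    refine (lintegral_mono_set hsub).trans ((lintegral_union_le _ _ _).trans (add_le_add ?_ h2))
    refine (lintegral_iUnion_le _ _).trans ?_
    rw [tsum_fintype, ← hsum]
    exact Finset.sum_le_sum fun i _ => le_add_self.trans (H i (hs i i.2) F v hv)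
  calc _ ≤ K * (X + Y) + (K * (X + Y) + A * (2 * volume Ω * (K * (X + Y)))) := add_le_add h1 h3
    _ = _ := by ring

end

section
variable {N : ℕ} {G : Type*} [NormedAddCommGroup G] [NormedSpace ℝ G]

theorem ContDiffOn.contDiffOn_iteratedFDeriv {Ω : Set (Euc N)} (hΩ : IsOpen Ω)
    {u : Euc N → G} (hu : ContDiffOn ℝ (⊤ : ℕ∞) u Ω) (j : ℕ) :
    ContDiffOn ℝ 1 (iteratedFDeriv ℝ j u) Ω := fun x hx => by
  have h := hu.contDiffAt (hΩ.mem_nhds hx)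
  refine (h.iteratedFDeriv_right (i := j) (m := 1) ?_).contDiffWithinAt
  exact_mod_cast le_top

theorem ContDiffOn.exists_norm_iteratedFDeriv_le {Ω : Set (Euc N)} (hΩ : IsOpen Ω)
    (hb : Bornology.IsBounded Ω) {u : Euc N → G}
    (hu : ContDiffOn ℝ (⊤ : ℕ∞) u (closure Ω)) (j : ℕ) :
    ∃ M, ∀ x ∈ Ω, ‖iteratedFDeriv ℝ j u x‖ ≤ M := by
  have hloc : ∀ x₀ ∈ closure Ω, ∃ W ∈ 𝓝[closure Ω] x₀, ∃ M, ∀ x ∈ Ω ∩ W,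
      ‖iteratedFDeriv ℝ j u x‖ ≤ M := by
    intro x₀ hx₀
    have h : ContDiffWithinAt ℝ j u (closure Ω) x₀ :=
      (hu x₀ hx₀).of_le (by exact_mod_cast le_top)
    obtain ⟨U, hU, P, hP⟩ := contDiffWithinAt_nat.1 h
    rw [Set.insert_eq_of_mem hx₀] at hU
    have hc := (hP.cont j le_rfl).norm x₀ (mem_of_mem_nhdsWithin hx₀ hU)
    have hev : ∀ᶠ x in 𝓝[U] x₀, ‖P x j‖ < ‖P x₀ j‖ + 1 :=
      hc.eventually (gt_mem_nhds (by linarith))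
    have hev' : ∀ᶠ x in 𝓝[closure Ω] x₀, x ∈ U ∧ ‖P x j‖ < ‖P x₀ j‖ + 1 :=
      Filter.Eventually.and hU (hev.filter_mono (nhdsWithin_le_of_mem hU))
    obtain ⟨V, hV, hxV, hVs⟩ := mem_nhdsWithin.1 hev'
    refine ⟨V, mem_nhdsWithin_of_mem_nhds (hV.mem_nhds hxV), ‖P x₀ j‖ + 1, fun x hx => ?_⟩
    have hsub : Ω ∩ V ⊆ U := fun y hy => (hVs ⟨hy.2, subset_closure hy.1⟩).1
    have ho : IsOpen (Ω ∩ V) := hΩ.inter hV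
    have he := (hP.mono hsub).eq_iteratedFDerivWithin_of_uniqueDiffOn le_rfl
      ho.uniqueDiffOn hx
    rw [iteratedFDerivWithin_of_isOpen j ho hx] at he
    rw [← he]
    exact (hVs ⟨hx.2, subset_closure hx.1⟩).2.le
  have hfin : ∃ M, ∀ x ∈ Ω ∩ closure Ω, ‖iteratedFDeriv ℝ j u x‖ ≤ M := by
    refine hb.isCompact_closure.induction_on
      (p := fun W => ∃ M, ∀ x ∈ Ω ∩ W, ‖iteratedFDeriv ℝ j u x‖ ≤ M) ?_ ?_ ?_ hloc
    · exact ⟨0, fun x hx => hx.2.elim⟩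
    · rintro s s' hs ⟨M, hM⟩
      exact ⟨M, fun x hx => hM x ⟨hx.1, hs hx.2⟩⟩
    · rintro s s' ⟨M, hM⟩ ⟨M', hM'⟩
      refine ⟨max M M', fun x hx => ?_⟩
      rcases hx.2 with h | h
      · exact (hM x ⟨hx.1, h⟩).trans (le_max_left _ _)
      · exact (hM' x ⟨hx.1, h⟩).trans (le_max_right _ _)
  obtain ⟨M, hM⟩ := hfin
  exact ⟨M, fun x hx => hM x ⟨hx, subset_closure hx⟩⟩

/-- The `L^q` norm over `Ω` of the derivative of order `j`, as an extended nonnegative real. -/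
def derivNorm (Ω : Set (Euc N)) (u : Euc N → G) (q : ℝ) (j : ℕ) : ENNReal :=
  (∫⁻ x in Ω, ‖iteratedFDeriv ℝ j u x‖ₑ ^ q) ^ (1 / q)

variable {Ω : Set (Euc N)} {u : Euc N → G}

theorem derivNorm_ne_top (hΩ : IsOpen Ω) (hb : Bornology.IsBounded Ω)
    (hu : ContDiffOn ℝ (⊤ : ℕ∞) u (closure Ω)) {q : ℝ} (hq : 0 < q) (j : ℕ) :
    derivNorm Ω u q j ≠ ⊤ := by
  obtain ⟨M, hM⟩ := hu.exists_norm_iteratedFDeriv_le hΩ hb j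
  refine ENNReal.rpow_ne_top_of_nonneg (by positivity) ?_
  have h : ∫⁻ x in Ω, ‖iteratedFDeriv ℝ j u x‖ₑ ^ q ≤ ∫⁻ _ in Ω, ENNReal.ofReal M ^ q := by
    refine setLIntegral_mono measurable_const fun x hx => ?_
    gcongr
    rw [← ofReal_norm]
    exact ENNReal.ofReal_le_ofReal (hM x hx)
  refine ne_top_of_le_ne_top ?_ h
  rw [setLIntegral_const]
  exact ENNReal.mul_ne_top (ENNReal.rpow_ne_top_of_nonneg hq.le ENNReal.ofReal_ne_top)
    hb.measure_lt_top.ne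

theorem rpow_integral_eq_toReal_derivNorm (hΩ : IsOpen Ω)
    (hu : ContDiffOn ℝ (⊤ : ℕ∞) u Ω) {q : ℝ} (hq : 0 < q) (j : ℕ) :
    (∫ x in Ω, ‖iteratedFDeriv ℝ j u x‖ ^ q) ^ (1 / q) = (derivNorm Ω u q j).toReal := by
  have hc := (hu.contDiffOn_iteratedFDeriv hΩ j).continuousOn.norm
  have hm : AEStronglyMeasurable (fun x => ‖iteratedFDeriv ℝ j u x‖ ^ q) (volume.restrict Ω) :=
    ((hc.aemeasurable hΩ.measurableSet).pow_const q).aestronglyMeasurable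
  rw [integral_eq_lintegral_of_nonneg_ae (ae_of_all _ fun x => by positivity) hm,
    ENNReal.toReal_rpow, derivNorm]
  congr 3
  funext x
  rw [← ENNReal.ofReal_rpow_of_nonneg (norm_nonneg _) hq.le, ofReal_norm]

theorem intSobNorm_eq_toReal (hΩ : IsOpen Ω) (hb : Bornology.IsBounded Ω)
    (hu : ContDiffOn ℝ (⊤ : ℕ∞) u (closure Ω)) {q : ℝ} (hq : 0 < q) (k : ℕ) :
    intSobNorm Ω k q u = (∑ j ∈ Finset.range (k + 1), derivNorm Ω u q j).toReal := by
  rw [ENNReal.toReal_sum fun j _ => derivNorm_ne_top hΩ hb hu hq j]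
  exact Finset.sum_congr rfl fun j _ =>
    rpow_integral_eq_toReal_derivNorm hΩ (hu.mono subset_closure) hq j

theorem derivNorm_le_derivNorm_mul (hΩ : IsOpen Ω)
    (hu : ContDiffOn ℝ (⊤ : ℕ∞) u Ω) {p q : ℝ} (hp : 0 < p) (hpq : p ≤ q) (j : ℕ) :
    derivNorm Ω u p j ≤ derivNorm Ω u q j * volume Ω ^ (1 / p - 1 / q) := by
  have hc := (hu.contDiffOn_iteratedFDeriv hΩ j).continuousOn.enorm
  have h := eLpNorm'_le_eLpNorm'_mul_rpow_measure_univ (μ := volume.restrict Ω)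
    (f := fun x => ‖iteratedFDeriv ℝ j u x‖ₑ) hp hpq
    (hc.aemeasurable hΩ.measurableSet).aestronglyMeasurable
  simpa [eLpNorm', derivNorm] using h

theorem enorm_integral_gagliardo_le {F : Type*} [NormedAddCommGroup F] {t r a : ℝ}
    (hr : 0 < r) (ha : a = N + r - t) (hΩ : IsOpen Ω) {v : Euc N → F} (hv : ContinuousOn v Ω) :
    ‖∫ x in Ω, ∫ y in Ω, ‖v x - v y‖ ^ r / ‖x - y‖ ^ a‖ₑ ≤
      ∫⁻ z in Ω ×ˢ Ω, gagKernel t r v z := by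
  rw [lintegral_gagKernel_eq hΩ.measurableSet hv]
  refine (enorm_integral_le_lintegral_enorm _).trans (lintegral_mono fun x => ?_)
  refine (enorm_integral_le_lintegral_enorm _).trans (lintegral_mono fun y => ?_)
  simp only [gagKernel]
  rw [Real.enorm_of_nonneg (by positivity), div_eq_mul_inv, ENNReal.ofReal_mul (by positivity),
    ← Real.rpow_neg (norm_nonneg _), ← ENNReal.ofReal_rpow_of_nonneg (norm_nonneg _) hr.le,
    ofReal_norm, ha]

end

theorem IsSmoothDomain.exists_derivNorm_add_gagKernel_le {N : ℕ} {Ω : Set (Euc N)}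
    (hΩ : IsSmoothDomain Ω) (hN : 1 ≤ N) {t r p γ : ℝ} (ht : 0 < t) (htN : t < N)
    (hr : 1 < r) (htr : t < r) (hp1 : 1 < p) (hpr : p * (N + t) = N * r) (hpγ : p ≤ γ) :
    ∃ C : ENNReal, C ≠ ⊤ ∧ ∀ (G : Type) [NormedAddCommGroup G] [NormedSpace ℝ G]
      [CompleteSpace G] (u : Euc N → G), ContDiffOn ℝ (⊤ : ℕ∞) u Ω → ∀ j : ℕ,
      derivNorm Ω u r j +
        (∫⁻ z in Ω ×ˢ Ω, gagKernel t r (iteratedFDeriv ℝ j u) z) ^ (1 / r) ≤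
        C * (derivNorm Ω u γ j + derivNorm Ω u γ (j + 1)) := by
  obtain ⟨C, hC, H⟩ := exists_global_gagKernel_le hΩ hN ht htN hr htr hp1 hpr
  have hr0 : 0 < r := by linarith
  have hp0 : 0 < p := by linarith
  have hΩfin : volume Ω ≠ ⊤ := hΩ.2.1.measure_lt_top.ne
  set V := volume Ω ^ (1 / p - 1 / γ) with hV
  have hVt : V ≠ ⊤ := ENNReal.rpow_ne_top_of_nonneg
    (sub_nonneg.2 (one_div_le_one_div_of_le hp0 hpγ)) hΩfin
  have hCr : C ^ (1 / r) ≠ ⊤ := ENNReal.rpow_ne_top_of_nonneg (by positivity) hC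
  refine ⟨2 * (C ^ (1 / r) * V), by finiteness, fun G _ _ _ u hu j => ?_⟩
  have h := H _ (iteratedFDeriv ℝ j u) (hu.contDiffOn_iteratedFDeriv hΩ.1 j)
  have hfd : ∀ x, ‖fderiv ℝ (iteratedFDeriv ℝ j u) x‖ₑ = ‖iteratedFDeriv ℝ (j + 1) u x‖ₑ := by
    intro x
    rw [← ofReal_norm, norm_fderiv_iteratedFDeriv, ofReal_norm]
  simp_rw [hfd] at h
  have key : (C * ((∫⁻ x in Ω, ‖iteratedFDeriv ℝ j u x‖ₑ ^ p) ^ (r / p) +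
      (∫⁻ x in Ω, ‖iteratedFDeriv ℝ (j + 1) u x‖ₑ ^ p) ^ (r / p))) ^ (1 / r) ≤
      C ^ (1 / r) * V * (derivNorm Ω u γ j + derivNorm Ω u γ (j + 1)) := by
    have hpow : ∀ I : ENNReal, (I ^ (r / p)) ^ (1 / r) = I ^ (1 / p) := fun I => by
      rw [← ENNReal.rpow_mul]
      congr 1
      field_simp
    rw [ENNReal.mul_rpow_of_nonneg _ _ (by positivity), mul_assoc]
    gcongr
    refine (ENNReal.rpow_add_le_add_rpow _ _ (by positivity)
      ((div_le_one hr0).2 hr.le)).trans ?_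
    rw [hpow, hpow, mul_add, mul_comm V, mul_comm V]
    exact add_le_add (derivNorm_le_derivNorm_mul hΩ.1 hu hp0 hpγ j)
      (derivNorm_le_derivNorm_mul hΩ.1 hu hp0 hpγ (j + 1))
  have h1 := (ENNReal.rpow_le_rpow (le_self_add.trans h)
    (show 0 ≤ 1 / r by positivity)).trans key
  have h2 := (ENNReal.rpow_le_rpow (le_add_self.trans h)
    (show 0 ≤ 1 / r by positivity)).trans key
  calc _ ≤ _ := add_le_add h1 h2
    _ = _ := by ring

theorem sobNorm_natCast {N : ℕ} {F : Type*} [NormedAddCommGroup F] [NormedSpace ℝ F]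
    (Ω : Set (Euc N)) (k : ℕ) (p : ℝ) (u : Euc N → F) :
    sobNorm Ω (k : ℝ) p u = intSobNorm Ω k p u := by
  unfold sobNorm
  rw [if_pos ⟨k, rfl⟩, Nat.floor_natCast]

theorem intSobNorm_le_mul_intSobNorm {N : ℕ} {G : Type*} [NormedAddCommGroup G]
    [NormedSpace ℝ G] {Ω : Set (Euc N)} (hΩ : IsOpen Ω) (hb : Bornology.IsBounded Ω)
    {u : Euc N → G} (hu : ContDiffOn ℝ (⊤ : ℕ∞) u (closure Ω)) {p q : ℝ} (hp : 0 < p)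
    (hpq : p ≤ q) (k : ℕ) :
    intSobNorm Ω k p u ≤ (volume Ω ^ (1 / p - 1 / q)).toReal * intSobNorm Ω k q u := by
  have hq : 0 < q := hp.trans_le hpq
  have hV : volume Ω ^ (1 / p - 1 / q) ≠ ⊤ := ENNReal.rpow_ne_top_of_nonneg
    (sub_nonneg.2 (one_div_le_one_div_of_le hp hpq)) hb.measure_lt_top.ne
  rw [intSobNorm_eq_toReal hΩ hb hu hp, intSobNorm_eq_toReal hΩ hb hu hq,
    ← ENNReal.toReal_mul]
  refine ENNReal.toReal_mono (ENNReal.mul_ne_top hV (ENNReal.sum_ne_top.2 fun j _ =>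
    derivNorm_ne_top hΩ hb hu hq j)) ?_
  rw [Finset.mul_sum]
  exact Finset.sum_le_sum fun j _ => by
    rw [mul_comm]
    exact derivNorm_le_derivNorm_mul hΩ (hu.mono subset_closure) hp hpq j

theorem IsSmoothDomain.exists_sobNorm_le {N : ℕ} {Ω : Set (Euc N)}
    (hΩ : IsSmoothDomain Ω) (hN : 1 ≤ N) {t r p γ : ℝ} (ht : 0 < t) (htN : t < N)
    (hr : 1 < r) (htr : t < r) (hp1 : 1 < p) (hpr : p * (N + t) = N * r) (hpγ : p ≤ γ) (k : ℕ) :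
    ∃ C : ℝ, 0 < C ∧ ∀ (G : Type) [NormedAddCommGroup G] [NormedSpace ℝ G]
      [CompleteSpace G] (u : Euc N → G), ContDiffOn ℝ (⊤ : ℕ∞) u (closure Ω) →
      sobNorm Ω (k + (1 - t / r)) r u ≤ C * intSobNorm Ω (k + 1) γ u := by
  have hr0 : 0 < r := by linarith
  have hγ0 : 0 < γ := by linarith
  obtain ⟨C, hC, H⟩ := hΩ.exists_derivNorm_add_gagKernel_le hN ht htN hr htr hp1 hpr hpγ
  have hθ0 : 0 < 1 - t / r := sub_pos.2 ((div_lt_one hr0).2 htr)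
  have hθ1 : 1 - t / r < 1 := by linarith [div_pos ht hr0]
  have hfloor : ⌊(k : ℝ) + (1 - t / r)⌋₊ = k := by
    rw [Nat.floor_eq_iff (by positivity)]
    constructor <;> linarith
  have hintg : ¬ ∃ l : ℕ, (k : ℝ) + (1 - t / r) = l := by
    rintro ⟨l, hl⟩
    have hlk : l = k := by rw [← hfloor, hl, Nat.floor_natCast]
    rw [hlk] at hl
    linarith
  set K : ENNReal := (k + 2) * (2 * C) with hK
  have hKt : K ≠ ⊤ := by finiteness
  refine ⟨K.toReal + 1, by positivity, fun G _ _ _ u hu => ?_⟩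
  have hu' := hu.mono (subset_closure (s := Ω))
  set σ := ∑ j ∈ Finset.range (k + 1 + 1), derivNorm Ω u γ j with hσ
  have hσt : σ ≠ ⊤ := ENNReal.sum_ne_top.2 fun j _ => derivNorm_ne_top hΩ.1 hΩ.2.1 hu hγ0 j
  set g := (∫⁻ z in Ω ×ˢ Ω, gagKernel t r (iteratedFDeriv ℝ k u) z) ^ (1 / r) with hg
  have hle : ∀ j ∈ Finset.range (k + 1), derivNorm Ω u r j +
      (∫⁻ z in Ω ×ˢ Ω, gagKernel t r (iteratedFDeriv ℝ j u) z) ^ (1 / r) ≤ 2 * C * σ := by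
    intro j hj
    rw [Finset.mem_range] at hj
    refine (H G u hu' j).trans ?_
    calc C * (derivNorm Ω u γ j + derivNorm Ω u γ (j + 1)) ≤ C * (σ + σ) := by
          gcongr <;>
          exact Finset.single_le_sum (f := fun i => derivNorm Ω u γ i) (fun i _ => zero_le)
            (Finset.mem_range.2 (by omega))
      _ = _ := by ring
  have htot : ∑ j ∈ Finset.range (k + 1), derivNorm Ω u r j + g ≤ K * σ := by
    calc _ ≤ ∑ j ∈ Finset.range (k + 1), 2 * C * σ + 2 * C * σ :=
          add_le_add (Finset.sum_le_sum fun j hj => le_self_add.trans (hle j hj))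
            (le_add_self.trans (hle k (Finset.self_mem_range_succ k)))
      _ = _ := by
          rw [Finset.sum_const, Finset.card_range, nsmul_eq_mul, hK]
          push_cast
          ring
  have hKσ : K * σ ≠ ⊤ := ENNReal.mul_ne_top hKt hσt
  have hgt : g ≠ ⊤ := ne_top_of_le_ne_top hKσ (le_add_self.trans htot)
  have hgag : (∫ x in Ω, ∫ y in Ω,
      ‖iteratedFDeriv ℝ k u x - iteratedFDeriv ℝ k u y‖ ^ r /
        ‖x - y‖ ^ ((N : ℝ) + ((k : ℝ) + (1 - t / r) - k) * r)) ^ (1 / r) ≤ g.toReal := by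
    have ha : (N : ℝ) + ((k : ℝ) + (1 - t / r) - k) * r = N + r - t := by
      field_simp
      ring
    have h := enorm_integral_gagliardo_le hr0 ha hΩ.1
      (hu'.contDiffOn_iteratedFDeriv hΩ.1 k).continuousOn
    have h0 : 0 ≤ ∫ x in Ω, ∫ y in Ω,
      ‖iteratedFDeriv ℝ k u x - iteratedFDeriv ℝ k u y‖ ^ r /
        ‖x - y‖ ^ ((N : ℝ) + ((k : ℝ) + (1 - t / r) - k) * r) :=
      integral_nonneg fun x => integral_nonneg fun y => by positivity
    rw [Real.enorm_of_nonneg h0] at h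
    have h' := ENNReal.rpow_le_rpow h (show 0 ≤ 1 / r by positivity)
    rw [ENNReal.ofReal_rpow_of_nonneg h0 (by positivity)] at h'
    exact (ENNReal.ofReal_le_iff_le_toReal hgt).1 h'
  unfold sobNorm
  rw [if_neg hintg, hfloor, intSobNorm_eq_toReal hΩ.1 hΩ.2.1 hu hr0,
    intSobNorm_eq_toReal hΩ.1 hΩ.2.1 hu hγ0, ← hσ]
  calc _ ≤ (∑ j ∈ Finset.range (k + 1), derivNorm Ω u r j).toReal + g.toReal := by gcongr
    _ = (∑ j ∈ Finset.range (k + 1), derivNorm Ω u r j + g).toReal :=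
        (ENNReal.toReal_add (ne_top_of_le_ne_top hKσ (le_self_add.trans htot)) hgt).symm
    _ ≤ (K * σ).toReal := ENNReal.toReal_mono hKσ htot
    _ = K.toReal * σ.toReal := ENNReal.toReal_mul
    _ ≤ (K.toReal + 1) * σ.toReal := by
        gcongr
        linarith

/-- Remark (ii): the continuous embedding
`W^{m-[m/r],γ}(Ω,ℝ^n) ⊂ W^{m-m/r,r}(Ω,ℝ^n)` when `γ ≥ Nr/(N+t)`, `t = m mod r`. -/
theorem stmt18 (N n m r : ℕ) (hN : 2 ≤ N) (hn : 1 ≤ n) (hm : 1 ≤ m)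
    (hr1 : 1 < r) (hrN : r ≤ N)
    (Ω : Set (Euc N)) (hΩ : IsSmoothDomain Ω)
    (γ : ℝ) (hγ1 : 1 < γ)
    (hcond : (N : ℝ) * r / ((N : ℝ) + (m % r : ℕ)) ≤ γ) :
    ∃ C : ℝ, 0 < C ∧
      ∀ u : Euc N → Fin n → ℝ, ContDiffOn ℝ (⊤ : ℕ∞) u (closure Ω) →
        sobNorm Ω ((m : ℝ) - (m : ℝ) / r) r u ≤
          C * sobNorm Ω ((m - m / r : ℕ) : ℝ) γ u := by
  have hN0 : (0 : ℝ) < N := by exact_mod_cast (by omega : 0 < N)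
  have hr0 : (0 : ℝ) < r := by exact_mod_cast (by omega : 0 < r)
  have hr1' : (1 : ℝ) < r := by exact_mod_cast hr1
  have hrN' : (r : ℝ) ≤ N := by exact_mod_cast hrN
  have hdm : (m : ℝ) = r * (m / r : ℕ) + (m % r : ℕ) := by
    exact_mod_cast (Nat.div_add_mod m r).symm
  have hqm : m / r < m := Nat.div_lt_self hm hr1
  have hs : (m : ℝ) - m / r = ((m - m / r : ℕ) : ℝ) - (m % r : ℕ) / r := by
    rw [Nat.cast_sub hqm.le]
    have : (m : ℝ) / r = (m / r : ℕ) + (m % r : ℕ) / r := by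
      rw [div_eq_iff hr0.ne', add_mul, div_mul_cancel₀ _ hr0.ne', mul_comm _ (r : ℝ)]
      exact hdm
    rw [this]
    ring
  rcases Nat.eq_zero_or_pos (m % r) with h0 | h0
  · rw [h0, Nat.cast_zero, add_zero, mul_div_cancel_left₀ _ hN0.ne'] at hcond
    rw [h0, Nat.cast_zero, zero_div, sub_zero] at hs
    refine ⟨(volume Ω ^ (1 / (r : ℝ) - 1 / γ)).toReal + 1, by positivity, fun u hu => ?_⟩
    rw [hs, sobNorm_natCast, sobNorm_natCast]
    refine (intSobNorm_le_mul_intSobNorm hΩ.1 hΩ.2.1 hu hr0 hcond _).trans ?_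
    have hpos : 0 ≤ intSobNorm Ω (m - m / r) γ u := Finset.sum_nonneg fun j _ =>
      Real.rpow_nonneg (integral_nonneg fun x => by positivity) _
    gcongr
    linarith
  · have ht : (0 : ℝ) < (m % r : ℕ) := by exact_mod_cast h0
    have htr : ((m % r : ℕ) : ℝ) < r := by exact_mod_cast Nat.mod_lt m (by omega)
    have hp1 : 1 < (N : ℝ) * r / (N + (m % r : ℕ)) := by
      rw [one_lt_div (by positivity)]
      have h2 : (2 : ℝ) ≤ r := by exact_mod_cast hr1
      nlinarith
    obtain ⟨C, hC, H⟩ := hΩ.exists_sobNorm_le (by omega : 1 ≤ N) ht (htr.trans_le hrN') hr1' htr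
      hp1 (div_mul_cancel₀ _ (by positivity)) hcond (m - m / r - 1)
    refine ⟨C, hC, fun u hu => ?_⟩
    have h := H (Fin n → ℝ) u hu
    have hk : m - m / r - 1 + 1 = m - m / r := by omega
    have hk' : (m : ℝ) - m / r = ((m - m / r - 1 : ℕ) : ℝ) + (1 - (m % r : ℕ) / r) := by
      rw [hs]
      have : ((m - m / r : ℕ) : ℝ) = ((m - m / r - 1 : ℕ) : ℝ) + 1 := by exact_mod_cast hk.symm
      rw [this]
      ring
    rw [hk] at h
    rw [hk', sobNorm_natCast]
    exact h
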